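/- Let p be a prime number with p ≡ 1 (mod 48) such that there exists w ∈ 𝔽_p with w⁴ − 2w² − 2 = 0 but there is no z ∈ 𝔽_p with z⁴ = 2 (equivalently: p splits completely in ℚ(√(1+√3)) and not in ℚ(2^{1/4})). Then every rational solution (x, y) ∈ ℚ × ℚ of y² = x(x² − p²)(x² − 4p²) satisfies y = 0 (hence x ∈ {0, p, −p, 2p, −2p}). -/

import Mathlib

/-- The naive height of a rational number. -/
def ratHeight (x : ℚ) : ℕ := max x.num.natAbs x.den

theorem abs_num_le_ratHeight (x : ℚ) : |x.num| ≤ (ratHeight x : ℤ) := by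
  rw [Int.abs_eq_natAbs]
  exact_mod_cast le_max_left _ _

theorem den_le_ratHeight (x : ℚ) : (x.den : ℤ) ≤ ratHeight x := by
  exact_mod_cast le_max_right _ _

theorem ratHeight_pos (x : ℚ) : 0 < ratHeight x :=
  lt_of_lt_of_le x.pos (le_max_right _ _)

theorem ratHeight_div_le (a b : ℤ) (h : ℕ) (hb : b ≠ 0) (ha' : |a| ≤ h) (hb' : |b| ≤ h) :
    ratHeight ((a : ℚ) / b) ≤ h := by
  have hq : (a : ℚ) / b = Rat.divInt a b := (Rat.divInt_eq_div a b).symm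
  rw [hq]
  have h1 := Rat.num_dvd a hb
  have h2 := Rat.den_dvd a b
  rw [Int.abs_eq_natAbs] at ha' hb'
  have ha'' : a.natAbs ≤ h := by exact_mod_cast ha'
  have hb'' : b.natAbs ≤ h := by exact_mod_cast hb'
  refine max_le ?_ ?_
  · by_cases ha : a = 0
    · simp [ha]
    · exact (Nat.le_of_dvd (Int.natAbs_pos.2 ha) (Int.natAbs_dvd_natAbs.2 h1)).trans ha''
  · exact (Nat.le_of_dvd (Int.natAbs_pos.2 hb) (by
      have := Int.natAbs_dvd_natAbs.2 h2; simpa using this)).trans hb''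

/-- Linear fractional transformations change the height by a bounded factor. -/
theorem ratHeight_moebius_le (x : ℚ) (α β γ δ : ℤ) (c : ℕ) (h1 : |α| + |β| ≤ c)
    (h2 : |γ| + |δ| ≤ c) (hx : γ * x + δ ≠ 0) :
    ratHeight ((α * x + β) / (γ * x + δ)) ≤ c * ratHeight x := by
  have hd : (x.den : ℚ) ≠ 0 := by exact_mod_cast x.den_nz
  have hxe : x = (x.num : ℚ) / (x.den : ℤ) := by
    simpa using (Rat.num_div_den x).symm
  have hn := abs_num_le_ratHeight x
  have hde := den_le_ratHeight x
  have hdp : (0 : ℤ) ≤ x.den := by positivity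
  have key : ∀ s t : ℤ, |s| + |t| ≤ c → |s * x.num + t * x.den| ≤ ((c * ratHeight x : ℕ) : ℤ) := by
    intro s t hst
    calc |s * x.num + t * x.den| ≤ |s| * |x.num| + |t| * |(x.den : ℤ)| := by
          rw [← abs_mul, ← abs_mul]; exact abs_add_le _ _
      _ ≤ |s| * ratHeight x + |t| * ratHeight x := by
          rw [abs_of_nonneg hdp]; gcongr
      _ = (|s| + |t|) * ratHeight x := by ring
      _ ≤ c * ratHeight x := by gcongr
      _ = _ := by push_cast; ring
  have hne : γ * x.num + δ * x.den ≠ 0 := by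
    intro h0
    apply hx
    have : ((γ * x.num + δ * x.den : ℤ) : ℚ) = 0 := by rw [h0]; simp
    push_cast at this
    rw [hxe]
    field_simp
    push_cast
    linarith
  have : (α * x + β) / (γ * x + δ)
      = ((α * x.num + β * x.den : ℤ) : ℚ) / ((γ * x.num + δ * x.den : ℤ) : ℚ) := by
    have e : ∀ s t : ℤ, (s * x + t : ℚ) = ((s * x.num + t * x.den : ℤ) : ℚ) / x.den := by
      intro s t
      push_cast
      rw [eq_div_iff hd]
      nth_rewrite 1 [hxe]
      push_cast
      field_simp
    rw [e, e, div_div_div_cancel_right₀ hd]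
  rw [this]
  exact ratHeight_div_le _ _ _ hne (key _ _ h1) (key _ _ h2)

theorem abs_cubic_le (c0 c1 c2 c3 m n h : ℤ) (hm : |m| ≤ h) (hn : |n| ≤ h) :
    |c0 * m ^ 3 + c1 * m ^ 2 * n + c2 * m * n ^ 2 + c3 * n ^ 3|
      ≤ (|c0| + |c1| + |c2| + |c3|) * h ^ 3 := by
  have hh : 0 ≤ h := (abs_nonneg m).trans hm
  calc _ ≤ |c0 * m ^ 3| + |c1 * m ^ 2 * n| + |c2 * m * n ^ 2| + |c3 * n ^ 3| := by
        refine (abs_add_le _ _).trans ?_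
        gcongr
        refine (abs_add_le _ _).trans ?_
        gcongr
        exact abs_add_le _ _
    _ = |c0| * |m| ^ 3 + |c1| * |m| ^ 2 * |n| + |c2| * |m| * |n| ^ 2 + |c3| * |n| ^ 3 := by
        simp only [abs_mul, abs_pow]
    _ ≤ |c0| * h ^ 3 + |c1| * h ^ 2 * h + |c2| * h * h ^ 2 + |c3| * h ^ 3 := by gcongr
    _ = _ := by ring

/-- If the coprime forms `G`, `K` of degree four satisfy Bezout relations with cubic cofactors,
then the rational function `G / K` multiplies the logarithmic height by four, up to a constant. -/
theorem ratHeight_pow_four_le (x z : ℚ) (G K : ℤ) (hK : K ≠ 0)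
    (hx : x * K = G) (R C : ℕ) (hR : R ≠ 0) (P₁ Q₁ P₂ Q₂ : ℤ)
    (h₁ : P₁ * G + Q₁ * K = R * z.num ^ 7) (h₂ : P₂ * G + Q₂ * K = R * z.den ^ 7)
    (hC₁ : |P₁| + |Q₁| ≤ C * (ratHeight z : ℤ) ^ 3)
    (hC₂ : |P₂| + |Q₂| ≤ C * (ratHeight z : ℤ) ^ 3) :
    ratHeight z ^ 4 ≤ C * ratHeight x := by
  have hmul : x.num * K = x.den * G := by
    have : (x.num * K : ℚ) = x.den * G := by
      rw [← hx, ← Rat.mul_den_eq_num x]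
      ring
    exact_mod_cast this
  have hcop : IsCoprime (x.den : ℤ) x.num := by
    rw [Int.isCoprime_iff_gcd_eq_one, Int.gcd_comm]
    exact x.reduced
  obtain ⟨t, rfl⟩ : (x.den : ℤ) ∣ K := hcop.dvd_of_dvd_mul_left (Dvd.intro _ hmul.symm)
  have hdz : (x.den : ℤ) ≠ 0 := by exact_mod_cast x.den_nz
  obtain rfl : G = x.num * t := by
    apply mul_left_cancel₀ hdz
    rw [← hmul]; ring
  have ht : t ≠ 0 := by rintro rfl; simp at hK
  have hzc : IsCoprime (z.num ^ 7) ((z.den : ℤ) ^ 7) := by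
    apply IsCoprime.pow
    rw [Int.isCoprime_iff_gcd_eq_one]
    exact z.reduced
  have htR : t ∣ (R : ℤ) := by
    obtain ⟨r, s, hrs⟩ := hzc
    have : (R : ℤ) = r * (R * z.num ^ 7) + s * (R * z.den ^ 7) := by
      linear_combination -(R : ℤ) * hrs
    rw [this, ← h₁, ← h₂]
    exact ⟨r * (P₁ * x.num + Q₁ * x.den) + s * (P₂ * x.num + Q₂ * x.den), by ring⟩
  have hRp : (0 : ℤ) < R := by positivity
  have htle : |t| ≤ R := Int.le_of_dvd hRp ((abs_dvd _ _).2 htR)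
  have hn := abs_num_le_ratHeight x
  have hde := den_le_ratHeight x
  have hdp : (0 : ℤ) ≤ x.den := by positivity
  have key : ∀ P Q v : ℤ, P * (x.num * t) + Q * (x.den * t) = R * v →
      |P| + |Q| ≤ C * (ratHeight z : ℤ) ^ 3 → |v| ≤ C * (ratHeight z : ℤ) ^ 3 * ratHeight x := by
    intro P Q v hv hPQ
    have e : R * |v| = |t| * |P * x.num + Q * x.den| := by
      have : (R : ℤ) * v = t * (P * x.num + Q * x.den) := by rw [← hv]; ring
      have := congrArg abs this
      rwa [abs_mul, abs_mul, abs_of_pos hRp] at this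
    have : |P * x.num + Q * x.den| ≤ C * (ratHeight z : ℤ) ^ 3 * ratHeight x := by
      calc |P * x.num + Q * x.den| ≤ |P| * |x.num| + |Q| * |(x.den : ℤ)| := by
            rw [← abs_mul, ← abs_mul]; exact abs_add_le _ _
        _ ≤ |P| * ratHeight x + |Q| * ratHeight x := by
            rw [abs_of_nonneg hdp]; gcongr
        _ = (|P| + |Q|) * ratHeight x := by ring
        _ ≤ _ := by gcongr
    refine le_of_mul_le_mul_left ?_ hRp
    rw [e]
    gcongr
  have k₁ := key _ _ _ h₁ hC₁
  have k₂ := key _ _ _ h₂ hC₂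
  have hz : (ratHeight z : ℤ) ^ 7 ≤ C * (ratHeight z : ℤ) ^ 3 * ratHeight x := by
    rw [abs_pow] at k₁ k₂
    rcases max_choice z.num.natAbs z.den with h | h
    · have : (ratHeight z : ℤ) = |z.num| := by rw [ratHeight, h, Int.abs_eq_natAbs]
      rw [← this] at k₁; exact k₁
    · have : (ratHeight z : ℤ) = |(z.den : ℤ)| := by rw [ratHeight, h, Nat.abs_cast]
      rw [← this] at k₂; exact k₂
  have hp : (0 : ℤ) < (ratHeight z : ℤ) ^ 3 := by
    have := ratHeight_pos z; positivity
  have : (ratHeight z : ℤ) ^ 4 ≤ C * ratHeight x := by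
    refine le_of_mul_le_mul_left ?_ hp
    calc _ = (ratHeight z : ℤ) ^ 7 := by ring
      _ ≤ _ := hz
      _ = _ := by ring
  exact_mod_cast this

/-- Halving a point on `D y² = x (x - A) (x - B)`. -/
theorem exists_half (A B D : ℤ) (hD : D ≠ 0) (hA : A ≠ 0) (hB : B ≠ 0) (hAB : A ≠ B) (x : ℚ)
    (h0 : IsSquare (D * x)) (h1 : IsSquare (D * (x - A))) (h2 : IsSquare (D * (x - B))) :
    ∃ z : ℚ, z * (z - A) * (z - B) ≠ 0 ∧ IsSquare (D * (z * (z - A) * (z - B))) ∧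
      x * (4 * (z * (z - A) * (z - B))) = (z ^ 2 - A * B) ^ 2 := by
  obtain ⟨a, ha⟩ := h0
  obtain ⟨b, hb⟩ := h1
  obtain ⟨c, hc⟩ := h2
  have hD' : (D : ℚ) ≠ 0 := by exact_mod_cast hD
  have hA' : (A : ℚ) ≠ 0 := by exact_mod_cast hA
  have hB' : (B : ℚ) ≠ 0 := by exact_mod_cast hB
  have hAB' : (A : ℚ) - B ≠ 0 := by rw [sub_ne_zero]; exact_mod_cast hAB
  obtain ⟨z, hz⟩ : ∃ z : ℚ, D * z = D * x + (a * b + a * c + b * c) :=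
    ⟨x + (a * b + a * c + b * c) / D, by field_simp⟩
  have e0 : D * z = (a + b) * (a + c) := by linear_combination hz + ha
  have e1 : D * (z - A) = (a + b) * (b + c) := by linear_combination hz + hb
  have e2 : D * (z - B) = (a + c) * (b + c) := by linear_combination hz + hc
  have f0 : D * A = (a - b) * (a + b) := by linear_combination ha - hb
  have f1 : D * B = (a - c) * (a + c) := by linear_combination ha - hc
  have f2 : D * (B - A) = (b - c) * (b + c) := by linear_combination hb - hc
  have n0 : a + b ≠ 0 := by
    intro h; rw [h, mul_zero] at f0; exact mul_ne_zero hD' hA' f0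
  have n1 : a + c ≠ 0 := by
    intro h; rw [h, mul_zero] at f1; exact mul_ne_zero hD' hB' f1
  have n2 : b + c ≠ 0 := by
    intro h; rw [h, mul_zero] at f2
    rcases mul_eq_zero.1 f2 with h | h
    · exact hD' h
    · exact hAB' (by linarith)
  have hprod : (D : ℚ) ^ 3 * (z * (z - A) * (z - B)) = ((a + b) * (a + c) * (b + c)) ^ 2 := by
    have : (D : ℚ) ^ 3 * (z * (z - A) * (z - B)) = (D * z) * (D * (z - A)) * (D * (z - B)) := by ring
    rw [this, e0, e1, e2]; ring
  refine ⟨z, ?_, ⟨(a + b) * (a + c) * (b + c) / D, ?_⟩, ?_⟩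
  · intro h
    rw [h, mul_zero] at hprod
    exact pow_ne_zero 2 (mul_ne_zero (mul_ne_zero n0 n1) n2) hprod.symm
  · field_simp
    linear_combination hprod
  · have hsq : (D : ℚ) ^ 2 * (z ^ 2 - A * B) = (a + b) * (a + c) * (2 * a * (b + c)) := by
      have : (D : ℚ) ^ 2 * (z ^ 2 - A * B) = (D * z) ^ 2 - (D * A) * (D * B) := by ring
      rw [this, e0, f0, f1]; ring
    have : (D : ℚ) ^ 4 * (x * (4 * (z * (z - A) * (z - B)))) = (D : ℚ) ^ 4 * (z ^ 2 - A * B) ^ 2 := by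
      calc _ = 4 * (D * x) * ((D : ℚ) ^ 3 * (z * (z - A) * (z - B))) := by ring
        _ = ((a + b) * (a + c) * (2 * a * (b + c))) ^ 2 := by rw [hprod, ha]; ring
        _ = _ := by rw [← hsq]; ring
    exact mul_left_cancel₀ (pow_ne_zero 4 hD') this

/-- Infinite descent on `D y² = x (x - A) (x - B)`. -/
theorem no_point_of_descent (A B D : ℤ) (hD : D ≠ 0) (hA : A ≠ 0) (hB : B ≠ 0) (hAB : A ≠ B)
    (C c : ℕ)
    (hheight : ∀ x z : ℚ, z * (z - A) * (z - B) ≠ 0 →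
      x * (4 * (z * (z - A) * (z - B))) = (z ^ 2 - A * B) ^ 2 →
      ratHeight z ^ 4 ≤ C * ratHeight x)
    (hclass : ∀ x : ℚ, x * (x - A) * (x - B) ≠ 0 → IsSquare (D * (x * (x - A) * (x - B))) →
      ∃ x' : ℚ, IsSquare (D * x') ∧ IsSquare (D * (x' - A)) ∧ IsSquare (D * (x' - B)) ∧
        ratHeight x' ≤ c * ratHeight x)
    (hsmall : ∀ z : ℚ, z * (z - A) * (z - B) ≠ 0 → IsSquare (D * (z * (z - A) * (z - B))) →
      C * c < ratHeight z ^ 3) (x : ℚ) (hx : IsSquare (D * (x * (x - A) * (x - B)))) :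
    x * (x - A) * (x - B) = 0 := by
  by_contra h0
  induction hn : ratHeight x using Nat.strong_induction_on generalizing x with
  | _ n ih =>
  subst hn
  obtain ⟨x', s0, s1, s2, hh⟩ := hclass x h0 hx
  obtain ⟨z, hz0, hz, hxz⟩ := exists_half A B D hD hA hB hAB x' s0 s1 s2
  refine ih _ ?_ z hz hz0 rfl
  by_contra! hle
  have h4 := hheight x' z hz0 hxz
  have h3 := hsmall z hz0 hz
  have : ratHeight z ^ 4 ≤ C * c * ratHeight z := by
    calc _ ≤ C * (c * ratHeight x) := h4.trans (by gcongr)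
      _ ≤ C * (c * ratHeight z) := by gcongr
      _ = _ := by ring
  have hp := ratHeight_pos z
  have : ratHeight z ^ 3 ≤ C * c := by
    refine le_of_mul_le_mul_right ?_ hp
    calc _ = ratHeight z ^ 4 := by ring
      _ ≤ _ := this
  omega

/-- The squarefree integers supported at the primes two and three. -/
def sixUnits : List ℤ := [1, -1, 2, -2, 3, -3, 6, -6]

/-- Whether `r` is `d` times one of the residues `S` modulo `N`. -/
def isSqClassMod (N : ℤ) (S : List ℤ) (d r : ℤ) : Bool := S.any fun s => (r - d * s) % N == 0

/-- All tuples of classes in `sixUnits` compatible with the residues `rs` modulo `N`. -/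
def sqClassesMod (N : ℤ) (S : List ℤ) : List ℤ → List (List ℤ)
  | [] => [[]]
  | r :: rs => (sixUnits.filter (isSqClassMod N S · r)).flatMap fun d =>
      (sqClassesMod N S rs).map (d :: ·)

/-- The pairs of residues modulo `N` that are not both divisible by `q`. -/
def primitivePairs (N q : ℕ) : List (ℤ × ℤ) :=
  ((List.range N).flatMap fun a : ℕ => (List.range N).map fun b : ℕ => ((a : ℤ), (b : ℤ))).filter
    fun v => !(v.1 % q == 0 && v.2 % q == 0)

/-- The value of a binary linear form. -/
def linForm (c v : ℤ × ℤ) : ℤ := c.1 * v.1 + c.2 * v.2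

/-- Compatibility of signs with the ordering of the linear forms on the upper half-plane. -/
def signCompatible (l : List ((ℤ × ℤ) × ℤ)) : Bool :=
  l.all (fun x => !(x.1.1 == 0) || decide (x.1.2 ≤ 0) || decide (0 < x.2)) &&
  l.all fun x => l.all fun y =>
    !(x.1.1 == y.1.1) || decide (x.1.2 < y.1.2) || decide (x.2 > 0) || decide (y.2 < 0)

/-- A necessary condition for being a square. -/
def maybeSquare (m : ℤ) : Bool := decide (0 < m) && isSqClassMod 5 [0, 1, 4] 1 m && isSqClassMod 7 [0, 1, 2, 4] 1 m

/-- A local certificate that every everywhere locally soluble tuple is one of `goods`. -/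
def selmerCheck (c : List (ℤ × ℤ)) (D : ℤ) (goods : List (List ℤ)) : Bool :=
  (primitivePairs 16 2).all fun v => (sqClassesMod 16 [0, 1, 4, 9] (c.map (linForm · v))).all fun ds =>
    !(maybeSquare (D * ds.prod)) || !(signCompatible (c.zip ds)) || goods.contains ds ||
    (primitivePairs 9 3).all fun v' =>
      !((c.zip ds).all fun x => isSqClassMod 9 [0, 1, 4, 7] x.2 (linForm x.1 v'))

theorem mem_sixUnits {s : ℕ} (h : s ∣ 6) (n : ℤ) (hn : n = s ∨ n = -s) : n ∈ sixUnits := by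
  have h6 : s ≤ 6 := Nat.le_of_dvd (by norm_num) h
  interval_cases s <;> rcases hn with rfl | rfl <;> revert h <;> decide

/-- Two-six-`p` part of a factor of a perfect square. -/
theorem exists_sqClass (p : ℕ) (hp : p = 1 ∨ p.Prime) (n M w : ℤ) (hw : w ≠ 0)
    (h : n * M = w ^ 2)
    (hq : ∀ q : ℕ, q.Prime → (q : ℤ) ∣ n → (q : ℤ) ∣ M → q = 2 ∨ q = 3 ∨ q = p) :
    ∃ d ∈ sixUnits, ∃ e : ℕ, (e = 1 ∨ e = p) ∧ ∃ u : ℤ, u ≠ 0 ∧ n = d * e * u ^ 2 := by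
  have hn : n ≠ 0 := by rintro rfl; apply hw; simpa using h.symm
  obtain ⟨s, b, hsb, hs⟩ := Nat.sq_mul_squarefree n.natAbs
  have hb : b ≠ 0 := by rintro rfl; simp at hsb; omega
  have hp0 : p ≠ 0 := by rcases hp with rfl | hp; · simp
                         exact hp.ne_zero
  have hN : b ^ 2 * (s * M.natAbs) = w.natAbs ^ 2 := by
    rw [← mul_assoc, hsb, ← Int.natAbs_mul, h, Int.natAbs_pow]
  obtain ⟨v, hv⟩ : b ∣ w.natAbs := (Nat.pow_dvd_pow_iff two_ne_zero).1 (Dvd.intro _ hN)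
  have hv' : s * M.natAbs = v ^ 2 := by
    have : b ^ 2 * (s * M.natAbs) = b ^ 2 * v ^ 2 := by rw [hN, hv]; ring
    exact Nat.eq_of_mul_eq_mul_left (by positivity) this
  have hprime : ∀ q : ℕ, q.Prime → q ∣ s → q = 2 ∨ q = 3 ∨ q = p := by
    intro q hqp hqs
    apply hq q hqp
    · exact Int.natCast_dvd.2 (by rw [← hsb]; exact hqs.mul_left _)
    · apply Int.natCast_dvd.2
      by_contra hqM
      have hqv : q ∣ v := hqp.dvd_of_dvd_pow (n := 2) (by rw [← hv']; exact hqs.mul_right _)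
      have h2 : q ^ 2 ∣ s * M.natAbs := by rw [hv']; exact pow_dvd_pow_of_dvd hqv 2
      have h3 : q ^ 2 ∣ s := by
        apply Nat.Coprime.dvd_of_dvd_mul_right _ h2
        exact Nat.Coprime.pow_left 2 ((Nat.Prime.coprime_iff_not_dvd hqp).2 hqM)
      rw [pow_two] at h3
      exact hqp.one_lt.ne' (Nat.isUnit_iff.1 (hs q h3))
  have hs6 : s ∣ 6 * p := by
    rw [← Nat.prod_primeFactors_of_squarefree hs]
    refine (Finset.prod_dvd_prod_of_subset _ (6 * p).primeFactors _ ?_).trans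
      (Nat.prod_primeFactors_dvd _)
    intro q hqs
    have hqp := Nat.prime_of_mem_primeFactors hqs
    refine Nat.mem_primeFactors.2 ⟨hqp, ?_, by positivity⟩
    rcases hprime q hqp (Nat.dvd_of_mem_primeFactors hqs) with rfl | rfl | rfl
    · exact Dvd.dvd.mul_right (by norm_num) _
    · exact Dvd.dvd.mul_right (by norm_num) _
    · exact dvd_mul_left _ _
  obtain ⟨y, e, hy, he, rfl⟩ := Nat.dvd_mul.1 hs6
  have he' : e = 1 ∨ e = p := by
    rcases hp with rfl | hp
    · left; simpa using he
    · exact (Nat.dvd_prime hp).1 he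
  rcases Int.natAbs_eq n with hneg | hneg
  · refine ⟨y, mem_sixUnits hy _ (Or.inl rfl), e, he', b, by exact_mod_cast hb, ?_⟩
    rw [hneg, ← hsb]; push_cast; ring
  · refine ⟨-y, mem_sixUnits hy _ (Or.inr rfl), e, he', b, by exact_mod_cast hb, ?_⟩
    rw [hneg, ← hsb]; push_cast; ring

theorem prime_dvd_six {q : ℕ} (hq : q.Prime) (h : (q : ℤ) ∣ 6) : q = 2 ∨ q = 3 := by
  have h' : q ∣ 2 * 3 := by exact_mod_cast h
  rcases hq.dvd_mul.1 h' with h | h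
  · left; exact (Nat.prime_dvd_prime_iff_eq hq Nat.prime_two).1 h
  · right; exact (Nat.prime_dvd_prime_iff_eq hq Nat.prime_three).1 h

theorem isSquare_of_mul_sq {n u w : ℤ} (hu : u ≠ 0) (h : n * u ^ 2 = w ^ 2) : IsSquare n := by
  obtain ⟨v, rfl⟩ : u ∣ w := (Int.pow_dvd_pow_iff two_ne_zero).1 (Dvd.intro_left _ h)
  refine ⟨v, mul_right_cancel₀ (pow_ne_zero 2 hu) ?_⟩
  rw [h]; ring

theorem dvd_six_of_mem {d : ℤ} (h : d ∈ sixUnits) : d ∣ 6 := by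
  revert d; decide

theorem prime_dvd_of_linForm {k : ℕ} {c : Fin k → ℤ × ℤ}
    (hdet : ∀ i j, i ≠ j → (c i).1 * (c j).2 - (c i).2 * (c j).1 ∣ 12) {a b : ℤ}
    (hab : IsCoprime a b) {q : ℕ} (hq : q.Prime) {i j : Fin k} (hij : i ≠ j)
    (hi : (q : ℤ) ∣ linForm (c i) (a, b)) (hj : (q : ℤ) ∣ linForm (c j) (a, b)) :
    q = 2 ∨ q = 3 := by
  have hqI := Nat.prime_iff_prime_int.1 hq
  set δ := (c i).1 * (c j).2 - (c i).2 * (c j).1 with hδ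
  have h1 : (q : ℤ) ∣ δ * a := by
    have : δ * a = (c j).2 * linForm (c i) (a, b) - (c i).2 * linForm (c j) (a, b) := by
      simp only [linForm, hδ]; ring
    rw [this]; exact dvd_sub (hi.mul_left _) (hj.mul_left _)
  have h2 : (q : ℤ) ∣ δ * b := by
    have : δ * b = (c i).1 * linForm (c j) (a, b) - (c j).1 * linForm (c i) (a, b) := by
      simp only [linForm, hδ]; ring
    rw [this]; exact dvd_sub (hj.mul_left _) (hi.mul_left _)
  have h3 : (q : ℤ) ∣ δ := by
    obtain ⟨r, s, hrs⟩ := hab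
    have : δ = r * (δ * a) + s * (δ * b) := by linear_combination -δ * hrs
    rw [this]; exact dvd_add (h1.mul_left _) (h2.mul_left _)
  have h4 : (q : ℤ) ∣ 2 * 6 := h3.trans (by simpa using hdet i j hij)
  rcases hqI.dvd_mul.1 h4 with h | h
  · left; exact (Nat.prime_dvd_prime_iff_eq hq Nat.prime_two).1 (by exact_mod_cast h)
  · exact prime_dvd_six hq h

theorem exists_sqClasses {k : ℕ} (c : Fin (k + 1) → ℤ × ℤ) (p : ℕ) (hp : p = 1 ∨ p.Prime)
    (hp48 : p % 48 = 1)
    (hdet : ∀ i j, i ≠ j → (c i).1 * (c j).2 - (c i).2 * (c j).1 ∣ 12) (D : ℤ) (hD : D ∣ 6)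
    (a b w : ℤ) (hab : IsCoprime a b) (hw : w ≠ 0)
    (h : D * p * ∏ i, linForm (c i) (a, b) = w ^ 2) :
    ∃ (d u : Fin (k + 1) → ℤ) (i₀ : Fin (k + 1)), (∀ i, d i ∈ sixUnits) ∧ (∀ i, u i ≠ 0) ∧
      (∀ i, linForm (c i) (a, b) = d i * (if i = i₀ then (p : ℤ) else 1) * u i ^ 2) ∧
      IsSquare (D * ∏ i, d i) := by
  have hp0 : (p : ℤ) ≠ 0 := by
    rcases hp with rfl | hp
    · simp
    · exact_mod_cast hp.ne_zero
  have hcls : ∀ i, ∃ d ∈ sixUnits, ∃ e : ℕ, (e = 1 ∨ e = p) ∧ ∃ u : ℤ, u ≠ 0 ∧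
      linForm (c i) (a, b) = d * e * u ^ 2 := by
    intro i
    apply exists_sqClass p hp _ (D * p * ∏ j ∈ Finset.univ.erase i, linForm (c j) (a, b)) w hw
    · rw [← h, ← Finset.mul_prod_erase Finset.univ _ (Finset.mem_univ i)]; ring
    · intro q hq hqi hqM
      have hqI := Nat.prime_iff_prime_int.1 hq
      rcases hqI.dvd_mul.1 hqM with h1 | h1
      · rcases hqI.dvd_mul.1 h1 with h2 | h2
        · rcases prime_dvd_six hq (h2.trans hD) with h | h <;> simp [h]
        · rcases hp with rfl | hp
          · exact absurd (isUnit_of_dvd_one (by simpa using h2)) hqI.not_isUnit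
          · right; right
            exact (Nat.prime_dvd_prime_iff_eq hq hp).1 (by exact_mod_cast h2)
      · obtain ⟨j, hj, hqj⟩ := (Prime.dvd_finsetProd_iff hqI _).1 h1
        rcases prime_dvd_of_linForm hdet hab hq (Finset.ne_of_mem_erase hj).symm hqi hqj with h | h
          <;> simp [h]
  choose d hd e he u hu hL using hcls
  have hplace : ∃ i₀, ∀ i, (e i : ℤ) = if i = i₀ then (p : ℤ) else 1 := by
    rcases hp with rfl | hp
    · exact ⟨0, fun i => by rcases he i with h | h <;> simp [h]⟩
    have hpI := Nat.prime_iff_prime_int.1 hp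
    have hne2 : p ≠ 2 := by rintro rfl; norm_num at hp48
    have hne3 : p ≠ 3 := by rintro rfl; norm_num at hp48
    have hp1 : p ≠ 1 := hp.one_lt.ne'
    by_cases hex : ∃ i, e i = p
    · obtain ⟨i₀, hi₀⟩ := hex
      refine ⟨i₀, fun i => ?_⟩
      split_ifs with hi
      · rw [hi, hi₀]
      · rcases he i with h | h
        · simp [h]
        · have := prime_dvd_of_linForm hdet hab hp hi
            (by rw [hL, h]; exact ((dvd_mul_left _ _).mul_right _))
            (by rw [hL, hi₀]; exact ((dvd_mul_left _ _).mul_right _))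
          omega
    · exfalso
      push Not at hex
      have h1 : ∀ i, e i = 1 := fun i => (he i).resolve_right (hex i)
      have hsq : (D * p * ∏ i, d i) * (∏ i, u i) ^ 2 = w ^ 2 := by
        rw [← h, ← Finset.prod_pow, mul_assoc, ← Finset.prod_mul_distrib]
        congr 1
        exact Finset.prod_congr rfl fun i _ => by rw [hL, h1]; simp
      obtain ⟨v, hv⟩ := isSquare_of_mul_sq (Finset.prod_ne_zero_iff.2 fun i _ => hu i) hsq
      have hpv : (p : ℤ) ∣ v := by
        rcases hpI.dvd_mul.1 (show (p : ℤ) ∣ v * v by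
          rw [← hv]; exact (dvd_mul_left _ _).mul_right _) with h | h <;> exact h
      obtain ⟨v', rfl⟩ := hpv
      have h2 : (p : ℤ) ∣ D * ∏ i, d i := by
        refine ⟨v' * v', mul_left_cancel₀ hp0 ?_⟩
        linear_combination hv
      rcases hpI.dvd_mul.1 h2 with h3 | h3
      · rcases prime_dvd_six hp (h3.trans hD) with h | h <;> omega
      · obtain ⟨j, -, hj⟩ := (Prime.dvd_finsetProd_iff hpI _).1 h3
        rcases prime_dvd_six hp (hj.trans (dvd_six_of_mem (hd j))) with h | h <;> omega
  obtain ⟨i₀, hi₀⟩ := hplace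
  refine ⟨d, u, i₀, hd, hu, fun i => by rw [hL, hi₀], ?_⟩
  refine isSquare_of_mul_sq (u := p * ∏ i, u i) (w := w)
    (mul_ne_zero hp0 (Finset.prod_ne_zero_iff.2 fun i _ => hu i)) ?_
  have : ∏ i, linForm (c i) (a, b) = (∏ i, d i) * p * (∏ i, u i) ^ 2 := by
    simp only [hL, hi₀, Finset.prod_mul_distrib, Finset.prod_ite_eq', Finset.mem_univ, if_true,
      Finset.prod_pow]
  rw [← h, this]; ring

theorem mem_sqClassesMod (N : ℤ) (S : List ℤ) {k : ℕ} (r d : Fin k → ℤ)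
    (hd : ∀ i, d i ∈ sixUnits) (h : ∀ i, isSqClassMod N S (d i) (r i) = true) :
    List.ofFn d ∈ sqClassesMod N S (List.ofFn r) := by
  induction k with
  | zero => simp [sqClassesMod]
  | succ k ih =>
    rw [List.ofFn_succ, List.ofFn_succ, sqClassesMod, List.mem_flatMap]
    exact ⟨d 0, List.mem_filter.2 ⟨hd 0, h 0⟩,
      List.mem_map.2 ⟨_, ih _ _ (fun i => hd _) (fun i => h _), rfl⟩⟩

theorem isSqClassMod_of_eq (N : ℕ) (hN : N ≠ 0) (S : List ℤ)
    (hS : ∀ s : Fin N, ((s * s % N : ℕ) : ℤ) ∈ S) (d r s e : ℤ) (h : (N : ℤ) ∣ r - d * s ^ 2)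
    (hre : (N : ℤ) ∣ r - e) : isSqClassMod N S d e = true := by
  have hN' : (N : ℤ) ≠ 0 := by exact_mod_cast hN
  obtain ⟨m, hm⟩ := Int.eq_ofNat_of_zero_le (Int.emod_nonneg s hN')
  have hlt : m < N := by
    have := Int.emod_lt_of_pos s (b := N) (by positivity)
    rw [hm] at this; exact_mod_cast this
  rw [isSqClassMod, List.any_eq_true]
  refine ⟨_, hS ⟨m, hlt⟩, ?_⟩
  rw [beq_iff_eq]
  apply Int.emod_eq_zero_of_dvd
  have h1 : (N : ℤ) ∣ s - m := by rw [← hm]; exact Int.dvd_self_sub_emod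
  have h2 : (N : ℤ) ∣ (m * m : ℤ) - ((m * m % N : ℕ) : ℤ) := by
    push_cast; exact Int.dvd_self_sub_emod
  have : e - d * ((m * m % N : ℕ) : ℤ) = -(r - e) + (r - d * s ^ 2) + d * (s + m) * (s - m)
      + d * ((m * m : ℤ) - ((m * m % N : ℕ) : ℤ)) := by ring
  rw [this]
  exact dvd_add (dvd_add (dvd_add (hre.neg_right) h) (h1.mul_left _)) (h2.mul_left _)

theorem exists_primitivePair (N q : ℕ) (hN : N ≠ 0) (hq : q.Prime) (hqN : q ∣ N) (a b : ℤ)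
    (hab : IsCoprime a b) :
    ∃ v ∈ primitivePairs N q, (N : ℤ) ∣ a - v.1 ∧ (N : ℤ) ∣ b - v.2 := by
  have hN' : (N : ℤ) ≠ 0 := by exact_mod_cast hN
  have hrep : ∀ x : ℤ, ∃ m < N, (N : ℤ) ∣ x - (m : ℤ) := by
    intro x
    obtain ⟨m, hm⟩ := Int.eq_ofNat_of_zero_le (Int.emod_nonneg x hN')
    refine ⟨m, ?_, by rw [← hm]; exact Int.dvd_self_sub_emod⟩
    have := Int.emod_lt_of_pos x (b := N) (by positivity)
    rw [hm] at this; exact_mod_cast this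
  obtain ⟨m, hm, hma⟩ := hrep a
  obtain ⟨n, hn, hnb⟩ := hrep b
  refine ⟨(m, n), ?_, hma, hnb⟩
  rw [primitivePairs, List.mem_filter]
  refine ⟨List.mem_flatMap.2 ⟨m, List.mem_range.2 hm, List.mem_map.2 ⟨n, List.mem_range.2 hn, rfl⟩⟩,
    ?_⟩
  have hqN' : (q : ℤ) ∣ N := by exact_mod_cast hqN
  by_contra hc
  simp only [Bool.not_eq_true, Bool.not_eq_false', Bool.and_eq_true, beq_iff_eq] at hc
  have h1 : (q : ℤ) ∣ a := by
    have := dvd_add (hqN'.trans hma) (Int.dvd_of_emod_eq_zero hc.1); simpa using this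
  have h2 : (q : ℤ) ∣ b := by
    have := dvd_add (hqN'.trans hnb) (Int.dvd_of_emod_eq_zero hc.2); simpa using this
  exact (Nat.prime_iff_prime_int.1 hq).not_isUnit (hab.isUnit_of_dvd' h1 h2)

theorem maybeSquare_of_isSquare {m : ℤ} (hm : m ≠ 0) (h : IsSquare m) : maybeSquare m = true := by
  obtain ⟨v, rfl⟩ := h
  have hv : v ≠ 0 := by rintro rfl; simp at hm
  simp only [maybeSquare, Bool.and_eq_true, decide_eq_true_eq]
  refine ⟨⟨mul_self_pos.2 hv, ?_⟩, ?_⟩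
  · exact isSqClassMod_of_eq 5 (by norm_num) _ (by decide) 1 (v * v) v _ (by ring_nf; simp) (by simp)
  · exact isSqClassMod_of_eq 7 (by norm_num) _ (by decide) 1 (v * v) v _ (by ring_nf; simp) (by simp)

theorem selmer_class {k : ℕ} (c : Fin (k + 1) → ℤ × ℤ) (p : ℕ) (hp : p = 1 ∨ p.Prime)
    (hp48 : p % 48 = 1)
    (hdet : ∀ i j, i ≠ j → (c i).1 * (c j).2 - (c i).2 * (c j).1 ∣ 12) (D : ℤ) (hD : D ∣ 6)
    (goods : List (List ℤ)) (hcheck : selmerCheck (List.ofFn c) D goods = true)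
    (a b w : ℤ) (hab : IsCoprime a b) (hb : 0 < b) (hw : w ≠ 0)
    (h : D * p * ∏ i, linForm (c i) (a, b) = w ^ 2) :
    ∃ (d u : Fin (k + 1) → ℤ) (i₀ : Fin (k + 1)), List.ofFn d ∈ goods ∧ (∀ i, u i ≠ 0) ∧
      ∀ i, linForm (c i) (a, b) = d i * (if i = i₀ then (p : ℤ) else 1) * u i ^ 2 := by
  obtain ⟨d, u, i₀, hd, hu, hL, hsq⟩ := exists_sqClasses c p hp hp48 hdet D hD a b w hab hw h
  refine ⟨d, u, i₀, ?_, hu, hL⟩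
  have hD0 : D ≠ 0 := by rintro rfl; simp at hD
  have hdne : ∀ i, d i ≠ 0 := fun i h0 => by have := hd i; rw [h0] at this; revert this; decide
  have hpp : (0 : ℤ) < p := by
    rcases hp with rfl | hp
    · simp
    · exact_mod_cast hp.pos
  have hsign : ∀ i, 0 < linForm (c i) (a, b) ↔ 0 < d i := by
    intro i
    have : (0 : ℤ) < (if i = i₀ then (p : ℤ) else 1) * u i ^ 2 := by
      have := hu i
      split_ifs <;> positivity
    rw [hL, mul_assoc]
    exact mul_pos_iff_of_pos_right this
  have hloc : ∀ (N : ℕ) (S : List ℤ), N ≠ 0 → (∀ s : Fin N, ((s * s % N : ℕ) : ℤ) ∈ S) →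
      (∃ r : ℤ, (N : ℤ) ∣ p - r ^ 2) → ∀ v : ℤ × ℤ, (N : ℤ) ∣ a - v.1 → (N : ℤ) ∣ b - v.2 →
      ∀ i, isSqClassMod N S (d i) (linForm (c i) v) = true := by
    rintro N S hN hS ⟨r, hr⟩ v h1 h2 i
    have hdiff : (N : ℤ) ∣ linForm (c i) (a, b) - linForm (c i) v := by
      have : linForm (c i) (a, b) - linForm (c i) v
          = (c i).1 * (a - v.1) + (c i).2 * (b - v.2) := by simp only [linForm]; ring
      rw [this]; exact dvd_add (h1.mul_left _) (h2.mul_left _)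
    by_cases hi : i = i₀
    · refine isSqClassMod_of_eq N hN S hS _ _ (r * u i) _ ?_ hdiff
      rw [hL, if_pos hi]
      have : d i * p * u i ^ 2 - d i * (r * u i) ^ 2 = d i * u i ^ 2 * (p - r ^ 2) := by ring
      rw [this]; exact hr.mul_left _
    · refine isSqClassMod_of_eq N hN S hS _ _ (u i) _ ?_ hdiff
      rw [hL, if_neg hi]; simp
  obtain ⟨v, hv, hv1, hv2⟩ := exists_primitivePair 16 2 (by norm_num) Nat.prime_two (by norm_num)
    a b hab
  obtain ⟨v', hv', hv1', hv2'⟩ := exists_primitivePair 9 3 (by norm_num) Nat.prime_three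
    (by norm_num) a b hab
  have h16 := hloc 16 [0, 1, 4, 9] (by norm_num) (by decide) ⟨1, by omega⟩ v hv1 hv2
  have h9 := hloc 9 [0, 1, 4, 7] (by norm_num) (by decide) (by
    have : p % 9 = 1 ∨ p % 9 = 4 ∨ p % 9 = 7 := by omega
    rcases this with h | h | h
    · exact ⟨1, by omega⟩
    · exact ⟨2, by omega⟩
    · exact ⟨4, by omega⟩) v' hv1' hv2'
  have hzip : (List.ofFn c).zip (List.ofFn d) = List.ofFn fun i => (c i, d i) := by
    apply List.ext_getElem
    · simp
    · intro i _ _; simp only [List.getElem_zip, List.getElem_ofFn]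
  have hc := List.all_eq_true.1 hcheck v hv
  have hc := List.all_eq_true.1 hc (List.ofFn d) (by
    rw [List.map_ofFn]; exact mem_sqClassesMod _ _ _ _ hd h16)
  rw [List.prod_ofFn, maybeSquare_of_isSquare (mul_ne_zero hD0
    (Finset.prod_ne_zero_iff.2 fun i _ => hdne i)) hsq, hzip] at hc
  have hs : signCompatible (List.ofFn fun i => (c i, d i)) = true := by
    simp only [signCompatible, Bool.and_eq_true, List.all_eq_true, List.mem_ofFn',
      Set.forall_mem_range, Bool.or_eq_true, Bool.not_eq_true', decide_eq_true_eq, beq_eq_false_iff_ne]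
    constructor
    · intro i
      by_contra! hcon
      have := (hsign i).1 (by simp only [linForm, hcon.1.1]; nlinarith [hcon.1.2])
      linarith [hcon.2]
    · intro i j
      by_contra! hcon
      have h1 := (hsign j).2 (lt_of_le_of_ne hcon.2 (hdne j).symm)
      have : 0 < linForm (c i) (a, b) := by
        refine lt_of_lt_of_le h1 ?_
        simp only [linForm, hcon.1.1.1]; nlinarith [hcon.1.1.2]
      linarith [(hsign i).1 this, hcon.1.2]
  have h9' : ((primitivePairs 9 3).all fun v' => !((List.ofFn fun i => (c i, d i)).all
      fun x => isSqClassMod 9 [0, 1, 4, 7] x.2 (linForm x.1 v'))) = false := by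
    rw [Bool.eq_false_iff]
    intro hall
    have := List.all_eq_true.1 hall v' hv'
    rw [Bool.not_eq_true', Bool.eq_false_iff] at this
    apply this
    rw [List.all_eq_true]
    simp only [List.mem_ofFn', Set.forall_mem_range]
    exact h9
  rw [hs, h9'] at hc
  simpa using hc

theorem isSquare_ratio (D k d e u v : ℤ) (he : e ≠ 0) (hv : v ≠ 0)
    (h : IsSquare (D * k * d * e)) :
    IsSquare ((D : ℚ) * (k * ((d * u ^ 2 : ℤ) : ℚ) / ((e * v ^ 2 : ℤ) : ℚ))) := by
  obtain ⟨r, hr⟩ := h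
  have hr' : (D * k * d * e : ℚ) = r * r := by exact_mod_cast hr
  have he' : (e : ℚ) ≠ 0 := by exact_mod_cast he
  have hv' : (v : ℚ) ≠ 0 := by exact_mod_cast hv
  refine ⟨r * u / (e * v), ?_⟩
  push_cast
  field_simp
  linear_combination (u : ℚ) ^ 2 * hr'

/-- A tuple of square classes on `D y² = x (x - A) (x - B)` that comes from a torsion point. -/
def IsTorsionClass (A B D d₀ d₁ d₂ d₃ : ℤ) : Prop :=
  (IsSquare (D * 1 * d₁ * d₀) ∧ IsSquare (D * 1 * d₂ * d₀) ∧ IsSquare (D * 1 * d₃ * d₀)) ∨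
  (IsSquare (D * (A * B) * d₀ * d₁) ∧ IsSquare (D * (-A) * d₃ * d₁) ∧
    IsSquare (D * (-B) * d₂ * d₁)) ∨
  (IsSquare (D * A * d₃ * d₂) ∧ IsSquare (D * (A * (A - B)) * d₀ * d₂) ∧
    IsSquare (D * (A - B) * d₁ * d₂)) ∨
  (IsSquare (D * B * d₂ * d₃) ∧ IsSquare (D * (B - A) * d₁ * d₃) ∧
    IsSquare (D * (B * (B - A)) * d₀ * d₃))

instance (A B D d₀ d₁ d₂ d₃ : ℤ) : Decidable (IsTorsionClass A B D d₀ d₁ d₂ d₃) := by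
  unfold IsTorsionClass; infer_instance

theorem exists_translate (A B D : ℤ) (c : ℕ) (hc : max (|A| + |A * B|) (|B| + |A * B|) ≤ c)
    (hc' : max (1 + |A|) (1 + |B|) ≤ c)
    (d₀ d₁ d₂ d₃ u₀ u₁ u₂ u₃ : ℤ) (x : ℚ) (h₀ : (x.den : ℤ) = d₀ * u₀ ^ 2)
    (h₁ : x.num = d₁ * u₁ ^ 2) (h₂ : x.num - A * x.den = d₂ * u₂ ^ 2)
    (h₃ : x.num - B * x.den = d₃ * u₃ ^ 2) (hx : x * (x - A) * (x - B) ≠ 0)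
    (ht : IsTorsionClass A B D d₀ d₁ d₂ d₃) :
    ∃ x' : ℚ, IsSquare (D * x') ∧ IsSquare (D * (x' - A)) ∧ IsSquare (D * (x' - B)) ∧
      ratHeight x' ≤ c * ratHeight x := by
  have hx0 : x ≠ 0 := fun h => hx (by rw [h]; ring)
  have hxA : x - A ≠ 0 := fun h => hx (by rw [h]; ring)
  have hxB : x - B ≠ 0 := fun h => hx (by rw [h]; ring)
  have hd : (x.den : ℚ) ≠ 0 := by exact_mod_cast x.den_nz
  have hn : (x.num : ℚ) = x * x.den := (Rat.mul_den_eq_num x).symm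
  have e₀ : ((d₀ * u₀ ^ 2 : ℤ) : ℚ) = x.den := by rw [← h₀]; simp
  have e₁ : ((d₁ * u₁ ^ 2 : ℤ) : ℚ) = x * x.den := by rw [← h₁, hn]
  have e₂ : ((d₂ * u₂ ^ 2 : ℤ) : ℚ) = (x - A) * x.den := by rw [← h₂]; push_cast; rw [hn]; ring
  have e₃ : ((d₃ * u₃ ^ 2 : ℤ) : ℚ) = (x - B) * x.den := by rw [← h₃]; push_cast; rw [hn]; ring
  have aux : ∀ d u : ℤ, ∀ q : ℚ, ((d * u ^ 2 : ℤ) : ℚ) = q → q ≠ 0 → d ≠ 0 ∧ u ≠ 0 := by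
    rintro d u q h hq
    constructor <;> rintro rfl <;> apply hq <;> rw [← h] <;> simp
  have n₀ := aux _ _ _ e₀ hd
  have n₁ := aux _ _ _ e₁ (mul_ne_zero hx0 hd)
  have n₂ := aux _ _ _ e₂ (mul_ne_zero hxA hd)
  have n₃ := aux _ _ _ e₃ (mul_ne_zero hxB hd)
  have hc1 := (le_max_left _ _).trans hc
  have hc2 := (le_max_right _ _).trans hc
  have hc3 := (le_max_left _ _).trans hc'
  have hc4 := (le_max_right _ _).trans hc'
  have hA0 := abs_nonneg A
  have hB0 := abs_nonneg B
  rcases ht with ⟨s, s', s''⟩ | ⟨s, s', s''⟩ | ⟨s, s', s''⟩ | ⟨s, s', s''⟩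
  · refine ⟨x, ?_, ?_, ?_, ?_⟩
    · convert isSquare_ratio D _ _ _ u₁ u₀ n₀.1 n₀.2 s using 2
      rw [e₀, e₁]; push_cast; field_simp
    · convert isSquare_ratio D _ _ _ u₂ u₀ n₀.1 n₀.2 s' using 2
      rw [e₀, e₂]; push_cast; field_simp
    · convert isSquare_ratio D _ _ _ u₃ u₀ n₀.1 n₀.2 s'' using 2
      rw [e₀, e₃]; push_cast; field_simp
    · exact Nat.le_mul_of_pos_left _ (by omega)
  · refine ⟨A * B / x, ?_, ?_, ?_, ?_⟩
    · convert isSquare_ratio D _ _ _ u₀ u₁ n₁.1 n₁.2 s using 2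
      rw [e₀, e₁]; push_cast; field_simp
    · convert isSquare_ratio D _ _ _ u₃ u₁ n₁.1 n₁.2 s' using 2
      rw [e₃, e₁]; push_cast; field_simp; ring
    · convert isSquare_ratio D _ _ _ u₂ u₁ n₁.1 n₁.2 s'' using 2
      rw [e₂, e₁]; push_cast; field_simp; ring
    · have := ratHeight_moebius_le x 0 (A * B) 1 0 c (by simp only [abs_zero]; omega)
        (by simp only [abs_zero, abs_one]; omega) (by simpa using hx0)
      convert this using 2
      push_cast; ring
  · refine ⟨A * (x - B) / (x - A), ?_, ?_, ?_, ?_⟩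
    · convert isSquare_ratio D _ _ _ u₃ u₂ n₂.1 n₂.2 s using 2
      rw [e₃, e₂]; field_simp
    · convert isSquare_ratio D _ _ _ u₀ u₂ n₂.1 n₂.2 s' using 2
      rw [e₀, e₂]; push_cast; field_simp; ring
    · convert isSquare_ratio D _ _ _ u₁ u₂ n₂.1 n₂.2 s'' using 2
      rw [e₁, e₂]; push_cast; field_simp; ring
    · have := ratHeight_moebius_le x A (-(A * B)) 1 (-A) c (by rw [abs_neg]; omega)
        (by rw [abs_neg, abs_one]; omega) (by push_cast; rwa [one_mul, ← sub_eq_add_neg])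
      convert this using 2
      push_cast; ring
  · refine ⟨B * (x - A) / (x - B), ?_, ?_, ?_, ?_⟩
    · convert isSquare_ratio D _ _ _ u₂ u₃ n₃.1 n₃.2 s using 2
      rw [e₂, e₃]; field_simp
    · convert isSquare_ratio D _ _ _ u₁ u₃ n₃.1 n₃.2 s' using 2
      rw [e₁, e₃]; push_cast; field_simp; ring
    · convert isSquare_ratio D _ _ _ u₀ u₃ n₃.1 n₃.2 s'' using 2
      rw [e₀, e₃]; push_cast; field_simp; ring
    · have := ratHeight_moebius_le x B (-(A * B)) 1 (-B) c (by rw [abs_neg]; omega)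
        (by rw [abs_neg, abs_one]; omega) (by push_cast; rwa [one_mul, ← sub_eq_add_neg])
      convert this using 2
      push_cast; ring

/-- The linear forms attached to the points at infinity, `0`, `A` and `B`. -/
def quadForms (A B : ℤ) : Fin 4 → ℤ × ℤ := ![(0, 1), (1, 0), (1, -A), (1, -B)]

theorem exists_num_den_eq_sq (A B D : ℤ) (x : ℚ) (hx : x * (x - A) * (x - B) ≠ 0) (hD : D ≠ 0)
    (h : IsSquare (D * (x * (x - A) * (x - B)))) :
    ∃ w : ℤ, w ≠ 0 ∧ D * ∏ i, linForm (quadForms A B i) (x.num, (x.den : ℤ)) = w ^ 2 := by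
  obtain ⟨y, hy⟩ := h
  have hd : (x.den : ℚ) ≠ 0 := by exact_mod_cast x.den_nz
  have hn : (x.num : ℚ) = x * x.den := (Rat.mul_den_eq_num x).symm
  have hprod : ((D * ∏ i, linForm (quadForms A B i) (x.num, (x.den : ℤ)) : ℤ) : ℚ)
      = (y * x.den ^ 2) ^ 2 := by
    simp [Fin.prod_univ_four, quadForms, linForm]
    rw [hn]
    linear_combination (x.den : ℚ) ^ 4 * hy
  have hsq : IsSquare ((D * ∏ i, linForm (quadForms A B i) (x.num, (x.den : ℤ)) : ℤ) : ℚ) :=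
    ⟨y * x.den ^ 2, by rw [hprod, pow_two]⟩
  obtain ⟨w, hw⟩ := Rat.isSquare_intCast_iff.1 hsq
  refine ⟨w, ?_, by rw [hw, pow_two]⟩
  rintro rfl
  rw [hw] at hprod
  have hy0 : y = 0 := by
    have := hprod.symm
    simp at this
    simpa using this
  rw [hy0, mul_zero] at hy
  exact mul_ne_zero (by exact_mod_cast hD) hx hy

theorem no_point_of_selmer (A B D : ℤ) (hD : D ∣ 6) (hA : A ≠ 0) (hB : B ≠ 0) (hAB : A ≠ B)
    (C c : ℕ)
    (hheight : ∀ x z : ℚ, z * (z - A) * (z - B) ≠ 0 →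
      x * (4 * (z * (z - A) * (z - B))) = (z ^ 2 - A * B) ^ 2 →
      ratHeight z ^ 4 ≤ C * ratHeight x)
    (hsmall : ∀ z : ℚ, z * (z - A) * (z - B) ≠ 0 → IsSquare (D * (z * (z - A) * (z - B))) →
      C * c < ratHeight z ^ 3)
    (hc : max (|A| + |A * B|) (|B| + |A * B|) ≤ c) (hc' : max (1 + |A|) (1 + |B|) ≤ c)
    (hdet : ∀ i j, i ≠ j → (quadForms A B i).1 * (quadForms A B j).2
      - (quadForms A B i).2 * (quadForms A B j).1 ∣ 12)
    (goods : List (List ℤ)) (hcheck : selmerCheck (List.ofFn (quadForms A B)) D goods = true)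
    (hgoods : ∀ l ∈ goods, IsTorsionClass A B D (l.getD 0 0) (l.getD 1 0) (l.getD 2 0) (l.getD 3 0))
    (x : ℚ) (hx : IsSquare (D * (x * (x - A) * (x - B)))) :
    x * (x - A) * (x - B) = 0 := by
  have hD0 : D ≠ 0 := by rintro rfl; simp at hD
  refine no_point_of_descent A B D hD0 hA hB hAB C c hheight ?_ hsmall x hx
  intro x hx0 hx
  obtain ⟨w, hw, hprod⟩ := exists_num_den_eq_sq A B D x hx0 hD0 hx
  obtain ⟨d, u, i₀, hd, hu, hL⟩ := selmer_class (quadForms A B) 1 (Or.inl rfl) rfl hdet D hD goods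
    hcheck x.num x.den w (by rw [Int.isCoprime_iff_gcd_eq_one]; exact x.reduced)
    (by exact_mod_cast x.pos) hw (by simpa using hprod)
  refine exists_translate A B D c hc hc' (d 0) (d 1) (d 2) (d 3) (u 0) (u 1) (u 2) (u 3) x
    ?_ ?_ ?_ ?_ hx0 (by simpa using hgoods _ hd)
  · simpa [quadForms, linForm] using hL 0
  · simpa [quadForms, linForm] using hL 1
  · simpa [quadForms, linForm, sub_eq_add_neg] using hL 2
  · simpa [quadForms, linForm, sub_eq_add_neg] using hL 3

theorem ratHeight_half_one_four_le (x z : ℚ) (hz : z * (z - (1 : ℤ)) * (z - (4 : ℤ)) ≠ 0)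
    (h : x * (4 * (z * (z - (1 : ℤ)) * (z - (4 : ℤ)))) = (z ^ 2 - (1 : ℤ) * (4 : ℤ)) ^ 2) :
    ratHeight z ^ 4 ≤ 12480 * ratHeight x := by
  have hd : (z.den : ℚ) ≠ 0 := by exact_mod_cast z.den_nz
  have hn : (z.num : ℚ) = z * z.den := (Rat.mul_den_eq_num z).symm
  have hm' := abs_num_le_ratHeight z
  have hn' : |(z.den : ℤ)| ≤ ratHeight z := by rw [Nat.abs_cast]; exact den_le_ratHeight z
  set m := z.num
  set n : ℤ := (z.den : ℤ) with hnn
  have hnq : (n : ℚ) = z.den := by simp [hnn]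
  have bd : ∀ c0 c1 c2 c3 : ℤ, _ := fun c0 c1 c2 c3 => abs_cubic_le c0 c1 c2 c3 m n _ hm' hn'
  refine ratHeight_pow_four_le x z ((m ^ 2 - 4 * n ^ 2) ^ 2) (4 * m * n * (m - n) * (m - 4 * n))
    ?_ ?_ 576 12480 (by norm_num)
    (576 * m ^ 3 + 2560 * m ^ 2 * n + (-3072) * m * n ^ 2 + 0 * n ^ 3)
    ((-640) * m ^ 3 + (-1280) * m ^ 2 * n + 1280 * m * n ^ 2 + 3072 * n ^ 3)
    (0 * m ^ 3 + (-12) * m ^ 2 * n + 40 * m * n ^ 2 + 36 * n ^ 3)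
    (3 * m ^ 3 + 5 * m ^ 2 * n + (-20) * m * n ^ 2 + (-40) * n ^ 3)
    ?_ ?_ ?_ ?_
  · intro h0
    apply hz
    have : ((4 * m * n * (m - n) * (m - 4 * n) : ℤ) : ℚ) = 0 := by rw [h0]; simp
    push_cast at this
    rw [hn, hnq] at this
    have h4 : (4 * (z.den : ℚ) ^ 4) * (z * (z - (1 : ℤ)) * (z - (4 : ℤ))) = 0 := by
      push_cast; linear_combination this
    exact (mul_eq_zero.1 h4).resolve_left (by positivity)
  · push_cast at h ⊢
    rw [hn, hnq]
    linear_combination (z.den : ℚ) ^ 4 * h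
  · push_cast; ring
  · push_cast; ring
  · refine (add_le_add (bd _ _ _ _) (bd _ _ _ _)).trans (le_of_eq ?_)
    norm_num; ring
  · refine (add_le_add (bd _ _ _ _) (bd _ _ _ _)).trans ?_
    rw [← add_mul]
    gcongr
    norm_num

theorem ratHeight_half_one_neg_one_le (x z : ℚ) (hz : z * (z - (1 : ℤ)) * (z - (-1 : ℤ)) ≠ 0)
    (h : x * (4 * (z * (z - (1 : ℤ)) * (z - (-1 : ℤ)))) = (z ^ 2 - (1 : ℤ) * (-1 : ℤ)) ^ 2) :
    ratHeight z ^ 4 ≤ 36 * ratHeight x := by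
  have hd : (z.den : ℚ) ≠ 0 := by exact_mod_cast z.den_nz
  have hn : (z.num : ℚ) = z * z.den := (Rat.mul_den_eq_num z).symm
  have hm' := abs_num_le_ratHeight z
  have hn' : |(z.den : ℤ)| ≤ ratHeight z := by rw [Nat.abs_cast]; exact den_le_ratHeight z
  set m := z.num
  set n : ℤ := (z.den : ℤ) with hnn
  have hnq : (n : ℚ) = z.den := by simp [hnn]
  have bd : ∀ c0 c1 c2 c3 : ℤ, _ := fun c0 c1 c2 c3 => abs_cubic_le c0 c1 c2 c3 m n _ hm' hn'
  refine ratHeight_pow_four_le x z ((m ^ 2 + n ^ 2) ^ 2) (4 * m * n * (m - n) * (m + n))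
    ?_ ?_ 16 36 (by norm_num)
    (16 * m ^ 3 + 0 * m ^ 2 * n + (-12) * m * n ^ 2 + 0 * n ^ 3)
    (0 * m ^ 3 + (-5) * m ^ 2 * n + 0 * m * n ^ 2 + (-3) * n ^ 3)
    (0 * m ^ 3 + (-12) * m ^ 2 * n + 0 * m * n ^ 2 + 16 * n ^ 3)
    (3 * m ^ 3 + 0 * m ^ 2 * n + 5 * m * n ^ 2 + 0 * n ^ 3)
    ?_ ?_ ?_ ?_
  · intro h0
    apply hz
    have : ((4 * m * n * (m - n) * (m + n) : ℤ) : ℚ) = 0 := by rw [h0]; simp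
    push_cast at this
    rw [hn, hnq] at this
    have h4 : (4 * (z.den : ℚ) ^ 4) * (z * (z - (1 : ℤ)) * (z - (-1 : ℤ))) = 0 := by
      push_cast; linear_combination this
    exact (mul_eq_zero.1 h4).resolve_left (by positivity)
  · push_cast at h ⊢
    rw [hn, hnq]
    linear_combination (z.den : ℚ) ^ 4 * h
  · push_cast; ring
  · push_cast; ring
  · refine (add_le_add (bd _ _ _ _) (bd _ _ _ _)).trans (le_of_eq ?_)
    norm_num; ring
  · refine (add_le_add (bd _ _ _ _) (bd _ _ _ _)).trans (le_of_eq ?_)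
    norm_num; ring

/-- A sufficient condition for `N` not to be a positive square. -/
def notPosSquare (N : ℤ) : Bool :=
  N.toNat == 0 || [7, 11, 13, 17, 19, 23, 29, 31, 37, 41, 43, 47, 53, 59, 61, 67].any fun q =>
    decide (1 < N.toNat ^ (q / 2) % q)

theorem not_isSquare_of_notPosSquare {N : ℤ} (hN : N ≠ 0) (h : notPosSquare N = true) :
    ¬IsSquare N := by
  rintro ⟨v, rfl⟩
  have hv : 0 < v * v := lt_of_le_of_ne (mul_self_nonneg v) hN.symm
  simp only [notPosSquare, Bool.or_eq_true, beq_iff_eq, List.any_eq_true, decide_eq_true_eq] at h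
  rcases h with h | ⟨q, hq, h⟩
  · omega
  have hq' : q.Prime ∧ 2 * (q / 2) = q - 1 := by
    simp only [List.mem_cons, List.not_mem_nil, or_false] at hq
    rcases hq with rfl | rfl | rfl | rfl | rfl | rfl | rfl | rfl | rfl | rfl | rfl | rfl | rfl | rfl | rfl |
      rfl <;>
      norm_num
  have hto : (v * v).toNat = v.natAbs ^ 2 := by
    rw [← Int.natAbs_mul_self' v, pow_two]; rfl
  rw [hto, ← pow_mul, hq'.2] at h
  have := Fact.mk hq'.1
  by_cases h0 : (v.natAbs : ZMod q) = 0
  · have h1 : q ∣ v.natAbs ^ (q - 1) :=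
      ((ZMod.natCast_eq_zero_iff _ _).1 h0).trans (dvd_pow_self _ (by have := hq'.1.one_lt; omega))
    rw [Nat.mod_eq_zero_of_dvd h1] at h; omega
  · have h1 := ZMod.pow_card_sub_one_eq_one h0
    have h2 : v.natAbs ^ (q - 1) ≡ 1 [MOD q] := by
      rw [← ZMod.natCast_eq_natCast_iff]; push_cast; exact h1
    rw [h2, Nat.mod_eq_of_lt hq'.1.one_lt] at h; omega

/-- A search certificate for the absence of points of small height on `D y² = x (x - A) (x - B)`. -/
def noSmallPoint (A B D : ℤ) (H : ℕ) : Bool :=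
  (List.range (H + 1)).all fun n => (List.range (H + 1)).all fun m =>
    notPosSquare (D * (n * (m * (m - A * n) * (m - B * n)))) &&
    notPosSquare (D * (n * (-m * (-m - A * n) * (-m - B * n))))

theorem lt_ratHeight_of_noSmallPoint (A B D : ℤ) (hD : D ≠ 0) (H : ℕ)
    (h : noSmallPoint A B D H = true) (z : ℚ)
    (hz : z * (z - A) * (z - B) ≠ 0) (hsq : IsSquare (D * (z * (z - A) * (z - B)))) :
    H < ratHeight z := by
  by_contra! hle
  obtain ⟨w, hw, hprod⟩ := exists_num_den_eq_sq A B D z hz hD hsq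
  have hprod' : D * (z.den * (z.num * (z.num - A * z.den) * (z.num - B * z.den))) = w ^ 2 := by
    rw [← hprod]
    simp only [Fin.prod_univ_four, quadForms, linForm, Matrix.cons_val]
    ring
  have hm : z.num.natAbs < H + 1 := by have : _ ≤ ratHeight z := le_max_left _ _; omega
  have hn : z.den < H + 1 := by have : _ ≤ ratHeight z := le_max_right _ _; omega
  have hc := List.all_eq_true.1 (List.all_eq_true.1 h _ (List.mem_range.2 hn)) _
    (List.mem_range.2 hm)
  rw [Bool.and_eq_true] at hc
  have hfin : notPosSquare (w ^ 2) = true := by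
    rw [← hprod']
    rcases Int.natAbs_eq z.num with h | h
    · rw [h]; exact hc.1
    · rw [h]; exact hc.2
  exact not_isSquare_of_notPosSquare (pow_ne_zero 2 hw) hfin ⟨w, pow_two w⟩

theorem no_point_one_four (D : ℤ) (hD : D ∣ 6) (goods : List (List ℤ))
    (hcheck : selmerCheck (List.ofFn (quadForms 1 4)) D goods = true)
    (hgoods : ∀ l ∈ goods, IsTorsionClass 1 4 D (l.getD 0 0) (l.getD 1 0) (l.getD 2 0) (l.getD 3 0))
    (hsmall : noSmallPoint 1 4 D 46 = true) (x : ℚ)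
    (hx : IsSquare (D * (x * (x - (1 : ℤ)) * (x - (4 : ℤ))))) :
    x * (x - (1 : ℤ)) * (x - (4 : ℤ)) = 0 := by
  have hD0 : D ≠ 0 := by rintro rfl; simp at hD
  refine no_point_of_selmer 1 4 D hD (by norm_num) (by norm_num) (by norm_num) 12480 8
    ratHeight_half_one_four_le ?_ (by decide) (by decide) (by decide) goods hcheck hgoods x hx
  intro z hz hsq
  have : 47 ≤ ratHeight z := lt_ratHeight_of_noSmallPoint 1 4 D hD0 46 hsmall z hz hsq
  exact lt_of_lt_of_le (by norm_num) (Nat.pow_le_pow_left this 3)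

theorem no_point_one_neg_one (D : ℤ) (hD : D ∣ 6) (goods : List (List ℤ))
    (hcheck : selmerCheck (List.ofFn (quadForms 1 (-1))) D goods = true)
    (hgoods : ∀ l ∈ goods,
      IsTorsionClass 1 (-1) D (l.getD 0 0) (l.getD 1 0) (l.getD 2 0) (l.getD 3 0))
    (hsmall : noSmallPoint 1 (-1) D 4 = true) (x : ℚ)
    (hx : IsSquare (D * (x * (x - (1 : ℤ)) * (x - (-1 : ℤ))))) :
    x * (x - (1 : ℤ)) * (x - (-1 : ℤ)) = 0 := by
  have hD0 : D ≠ 0 := by rintro rfl; simp at hD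
  refine no_point_of_selmer 1 (-1) D hD (by norm_num) (by norm_num) (by norm_num) 36 2
    ratHeight_half_one_neg_one_le ?_ (by decide) (by decide) (by decide) goods hcheck hgoods x hx
  intro z hz hsq
  have : 5 ≤ ratHeight z := lt_ratHeight_of_noSmallPoint 1 (-1) D hD0 4 hsmall z hz hsq
  exact lt_of_lt_of_le (by norm_num) (Nat.pow_le_pow_left this 3)

theorem eq_zero_of_no_point (A B D : ℤ)
    (hno : ∀ x : ℚ, IsSquare (D * (x * (x - A) * (x - B))) → x * (x - A) * (x - B) = 0)
    (s t w : ℤ) (h : D * (t * s * (s - A * t) * (s - B * t)) = w ^ 2) : w = 0 := by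
  by_cases ht : t = 0
  · rw [ht] at h
    simpa using h.symm
  have ht' : (t : ℚ) ≠ 0 := by exact_mod_cast ht
  have hq : (D * (t * s * (s - A * t) * (s - B * t)) : ℚ) = w ^ 2 := by exact_mod_cast h
  have h0 := hno (s / t) ⟨w / t ^ 2, by field_simp; linear_combination hq⟩
  have h1 : (D * (t * s * (s - A * t) * (s - B * t)) : ℚ)
      = D * t ^ 4 * (s / t * (s / t - A) * (s / t - B)) := by field_simp
  rw [h0, mul_zero, hq] at h1
  exact_mod_cast pow_eq_zero_iff two_ne_zero |>.1 h1

theorem eq_zero_of_one_four {D : ℤ} (hD : D ∈ [1, 2, -2]) {s t w : ℤ}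
    (h : D * (t * s * (s - t) * (s - 4 * t)) = w ^ 2) : w = 0 := by
  refine eq_zero_of_no_point 1 4 D ?_ s t w (by rw [one_mul]; exact h)
  simp only [List.mem_cons, List.not_mem_nil, or_false] at hD
  rcases hD with rfl | rfl | rfl
  · exact no_point_one_four 1 (by decide)
      [[1, 1, -3, -3], [1, 1, -1, -1], [1, 1, 1, 1], [1, 1, 3, 3]]
      (by decide +kernel) (by decide +kernel) (by decide +kernel)
  · exact no_point_one_four 2 (by decide)
      [[1, 1, -6, -3], [1, 1, 3, 6], [1, 2, -1, -1], [2, 1, 1, 1]]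
      (by decide +kernel) (by decide +kernel) (by decide +kernel)
  · exact no_point_one_four (-2) (by decide)
      [[1, -2, -1, -1], [1, 1, 3, -6], [1, 1, 6, -3], [2, -1, -1, -1]]
      (by decide +kernel) (by decide +kernel) (by decide +kernel)

theorem eq_zero_of_congruent {n : ℤ} (hn : n ∈ [1, 2]) {s t w : ℤ}
    (h : n * (t * s * (s - t) * (s + t)) = w ^ 2) : w = 0 := by
  refine eq_zero_of_no_point 1 (-1) n ?_ s t w (by rw [← h]; ring)
  simp only [List.mem_cons, List.not_mem_nil, or_false] at hn
  rcases hn with rfl | rfl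
  · exact no_point_one_neg_one 1 (by decide)
      [[1, -1, -2, 2], [1, -1, -1, 1], [1, 1, 1, 1], [1, 1, 2, 2]]
      (by decide +kernel) (by decide +kernel) (by decide +kernel)
  · exact no_point_one_neg_one 2 (by decide)
      [[1, -2, -1, 1], [1, -1, -2, 1], [1, 1, 1, 2], [2, 1, 1, 1]]
      (by decide +kernel) (by decide +kernel) (by decide +kernel)

section

variable {p : ℕ} [Fact p.Prime]

theorem ZMod.intCast_isSquare_of_mem (hp48 : p % 48 = 1) {d : ℤ} (hd : d ∈ sixUnits) :
    IsSquare (d : ZMod p) := by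
  have h1 : IsSquare (-1 : ZMod p) := ZMod.exists_sq_eq_neg_one_iff.2 (by omega)
  have h2 : IsSquare (2 : ZMod p) := (ZMod.exists_sq_eq_two_iff (by omega)).2 (by omega)
  have h3 : IsSquare (3 : ZMod p) := by
    have : Fact (Nat.Prime 3) := ⟨Nat.prime_three⟩
    have h := (ZMod.exists_sq_eq_prime_iff_of_mod_four_eq_one (p := p) (q := 3) (by omega)
      (by norm_num)).2 (by
        have : (p : ZMod 3) = (1 : ℕ) := by
          rw [ZMod.natCast_eq_natCast_iff]; unfold Nat.ModEq; omega
        rw [this]; exact ⟨1, by simp⟩)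
    exact_mod_cast h
  simp only [sixUnits, List.mem_cons, List.not_mem_nil, or_false] at hd
  rcases hd with rfl | rfl | rfl | rfl | rfl | rfl | rfl | rfl
  · simp
  · simpa using h1
  · simpa using h2
  · simpa using h1.mul h2
  · simpa using h3
  · simpa using h1.mul h3
  · have := h2.mul h3; norm_num at this; simpa using this
  · have := h1.mul (h2.mul h3); norm_num at this; simpa using this

/-- If `p` is a square modulo every odd prime factor of `v`, then `v` is a square modulo `p`. -/
theorem ZMod.intCast_isSquare_of_forall_prime (hp48 : p % 48 = 1) (v A B : ℤ) (hv : v ≠ 0)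
    (h : ∀ q : ℕ, q.Prime → q ≠ 2 → (q : ℤ) ∣ v → (q : ℤ) ∣ p * A ^ 2 - B ^ 2 ∧ ¬(q : ℤ) ∣ A) :
    IsSquare (v : ZMod p) := by
  have hnat : ∀ m : ℕ, m ≠ 0 → (m : ℤ) ∣ v → IsSquare (m : ZMod p) := by
    intro m
    induction m using Nat.recOnMul with
    | zero => intro h; exact absurd rfl h
    | one => intro _ _; simp
    | prime q hq =>
      intro _ hqv
      have := Fact.mk hq
      by_cases hq2 : q = 2
      · subst hq2
        exact_mod_cast ZMod.intCast_isSquare_of_mem (d := 2) hp48 (by decide)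
      · obtain ⟨h1, h2⟩ := h q hq hq2 hqv
        rw [ZMod.exists_sq_eq_prime_iff_of_mod_four_eq_one (by omega) hq2]
        have hA : (A : ZMod q) ≠ 0 := by rwa [Ne, ZMod.intCast_zmod_eq_zero_iff_dvd]
        have h3 := (ZMod.intCast_zmod_eq_zero_iff_dvd _ q).2 h1
        push_cast at h3
        refine ⟨B / A, ?_⟩
        field_simp
        linear_combination h3
    | mul a b ha hb =>
      intro hab hdv
      push_cast at hdv ⊢
      exact (ha (left_ne_zero_of_mul hab) ((dvd_mul_right _ _).trans hdv)).mul
        (hb (right_ne_zero_of_mul hab) ((dvd_mul_left _ _).trans hdv))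
  have h0 := hnat v.natAbs (Int.natAbs_ne_zero.2 hv) (Int.natAbs_dvd.2 dvd_rfl)
  rcases Int.natAbs_eq v with hs | hs
  · rw [hs, Int.cast_natCast]; exact h0
  · rw [hs]
    have := (ZMod.intCast_isSquare_of_mem (p := p) (d := -1) hp48 (by decide)).mul h0
    push_cast at this ⊢
    simpa using this

theorem exists_sqClass_sub (X Y K v : ℤ) (hK : K ∣ 6) (hv : v ≠ 0)
    (h : (X - Y) * (X + Y) = K * v ^ 2)
    (hXY : ∀ q : ℕ, q.Prime → (q : ℤ) ∣ X → (q : ℤ) ∣ Y → q = 2 ∨ q = 3) :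
    ∃ d ∈ sixUnits, ∃ u : ℤ, X - Y = d * u ^ 2 := by
  have hK0 : K ≠ 0 := by rintro rfl; simp at hK
  obtain ⟨d, hd, e, he, u, -, hu⟩ := exists_sqClass 1 (Or.inl rfl) (X - Y) (K * (X + Y)) (K * v)
    (mul_ne_zero hK0 hv) (by linear_combination K * h) (by
      intro q hq h1 h2
      have hqI := Nat.prime_iff_prime_int.1 hq
      rw [← or_assoc]; left
      rcases hqI.dvd_mul.1 h2 with h3 | h3
      · exact prime_dvd_six hq (h3.trans hK)
      · have h4 : (q : ℤ) ∣ 2 * X := by have := dvd_add h1 h3; ring_nf at this ⊢; exact this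
        have h5 : (q : ℤ) ∣ 2 * Y := by have := dvd_sub h3 h1; ring_nf at this ⊢; exact this
        by_cases hq2 : q = 2
        · exact Or.inl hq2
        · have hn2 : ¬(q : ℤ) ∣ 2 := fun h => hq2
            ((Nat.prime_dvd_prime_iff_eq hq Nat.prime_two).1 (by exact_mod_cast h))
          exact hXY q hq ((hqI.dvd_mul.1 h4).resolve_left hn2) ((hqI.dvd_mul.1 h5).resolve_left hn2))
  refine ⟨d, hd, u, ?_⟩
  rw [hu]
  rcases he with rfl | rfl <;> simp

theorem two_eq_fourth_power (hp48 : p % 48 = 1) (α β κ ℓ : ZMod p) (hβ0 : β ≠ 0) (hκ0 : κ ≠ 0)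
    (hβ : IsSquare β) (hκ : IsSquare κ) (hℓ : IsSquare ℓ) (h : ℓ = κ * α)
    (h2 : α ^ 2 = 2 * β ^ 2 ∨ α ^ 2 = -2 * β ^ 2) : ∃ z : ZMod p, z ^ 4 = 2 := by
  obtain ⟨i, hi⟩ := ZMod.intCast_isSquare_of_mem (p := p) (d := -1) hp48 (by decide)
  obtain ⟨r, hr⟩ := ZMod.intCast_isSquare_of_mem (p := p) (d := 2) hp48 (by decide)
  push_cast at hi hr
  have h20 : (2 : ZMod p) ≠ 0 := by
    intro h
    have := (ZMod.natCast_eq_zero_iff 2 p).1 (by exact_mod_cast h)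
    have := Nat.le_of_dvd (by norm_num) this
    have := (Fact.out : p.Prime).one_lt
    omega
  have hr0 : r ≠ 0 := by rintro rfl; apply h20; rw [hr]; ring
  obtain ⟨b, rfl⟩ := hβ
  obtain ⟨k, rfl⟩ := hκ
  obtain ⟨l, rfl⟩ := hℓ
  have hb0 : b ≠ 0 := by rintro rfl; simp at hβ0
  have hk0 : k ≠ 0 := by rintro rfl; simp at hκ0
  have hα : α = (l / k) ^ 2 := by field_simp; linear_combination -h
  rcases h2 with h2 | h2
  · refine ⟨l / k / b, ?_⟩
    have : (l / k / b) ^ 4 = ((l / k) ^ 2) ^ 2 / b ^ 4 := by field_simp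
    rw [this, ← hα, h2]; field_simp
  · refine ⟨l / k / b * ((1 + i) / r), ?_⟩
    have : (l / k / b * ((1 + i) / r)) ^ 4 = ((l / k) ^ 2) ^ 2 / b ^ 4 * ((1 + i) ^ 4 / r ^ 4) := by
      field_simp
    have h3 : (1 + i) ^ 4 = -4 := by linear_combination (-i ^ 2 - 4 * i - 5) * hi
    have h4 : r ^ 4 = 4 := by linear_combination (-r ^ 2 - 2) * hr
    have h40 : (4 : ZMod p) ≠ 0 := by rw [← h4]; exact pow_ne_zero 4 hr0
    rw [this, ← hα, h2, h3, h4]; field_simp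

end

/-- Among the classes allowed by the local conditions modulo `16` and `9`, only the one of the
point at infinity survives the quadratic reciprocity conditions at `p`. -/
theorem twist_class_infinity {p : ℕ} (hp : p.Prime) (hp48 : p % 48 = 1)
    (h2 : ¬∃ z : ZMod p, z ^ 4 = 2) (s t u₀ u₁ u₂ u₃ d₀ d₁ d₂ d₃ : ℤ) (hst : IsCoprime s t)
    (hu₁ : u₁ ≠ 0) (hu₂ : u₂ ≠ 0) (hu₃ : u₃ ≠ 0)
    (hd : [d₀, d₁, d₂, d₃] ∈ [[1, 1, -6, -3], [1, 1, 3, 6], [1, 2, -1, -1],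
      [1, -2, -1, -1], [1, 1, 3, -6], [1, 1, 6, -3]])
    (e₀ : t = d₀ * p * u₀ ^ 2) (e₁ : s - 0 * t = d₁ * u₁ ^ 2) (e₂ : s - 1 * t = d₂ * u₂ ^ 2)
    (e₃ : s - 4 * t = d₃ * u₃ ^ 2) : False := by
  have := Fact.mk hp
  apply h2
  have hcop : ∀ q : ℕ, q.Prime → ∀ k : ℤ, (q : ℤ) ∣ s - k * t → ¬(q : ℤ) ∣ t := by
    intro q hq k h h'
    have hs : (q : ℤ) ∣ s := by have := dvd_add h (h'.mul_left k); simpa using this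
    exact (Nat.prime_iff_prime_int.1 hq).not_isUnit (hst.isUnit_of_dvd' hs h')
  have hdvd : ∀ {q k v c : ℤ}, s - k * t = c * v ^ 2 → q ∣ v → q ∣ s - k * t := by
    intro q k v c h hq
    rw [h]; exact hq.trans ((dvd_pow_self _ two_ne_zero).mul_left _)
  have hpt : (p : ℤ) ∣ t := ⟨d₀ * u₀ ^ 2, by rw [e₀]; ring⟩
  have ht0 : (t : ZMod p) = 0 := (ZMod.intCast_zmod_eq_zero_iff_dvd _ _).2 hpt
  have hne : ∀ {k v c : ℤ}, s - k * t = c * v ^ 2 → (v : ZMod p) ≠ 0 := fun h h' =>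
    hcop p hp _ (hdvd h ((ZMod.intCast_zmod_eq_zero_iff_dvd _ _).1 h')) hpt
  have hd₀ : d₀ = 1 := by revert hd; simp; grind
  rw [hd₀, one_mul] at e₀
  have hden : ∀ {k v c : ℤ} (m y : ℤ), v ≠ 0 → s - k * t = c * v ^ 2 → m ∣ 2 →
      v ∣ m ^ 2 * t - y ^ 2 → IsSquare (v : ZMod p) := by
    intro k v c m y hv h hm hy
    refine ZMod.intCast_isSquare_of_forall_prime hp48 v (m * u₀) y hv fun q hq hq2 hqv => ⟨?_, ?_⟩
    · have : p * (m * u₀) ^ 2 - y ^ 2 = m ^ 2 * t - y ^ 2 := by rw [e₀]; ring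
      rw [this]; exact hqv.trans hy
    · intro h'
      rcases (Nat.prime_iff_prime_int.1 hq).dvd_mul.1 h' with h' | h'
      · exact hq2 ((Nat.prime_dvd_prime_iff_eq hq Nat.prime_two).1 (by exact_mod_cast h'.trans hm))
      · exact hcop q hq k (hdvd h hqv) (by
          rw [e₀]; exact h'.trans ((dvd_pow_self _ two_ne_zero).mul_left _))
  have hfac : ∀ {k v c k' v' c' : ℤ} (X Y K w : ℤ), s - k * t = c * v ^ 2 →
      s - k' * t = c' * v' ^ 2 → k - k' ∣ 12 → X ∣ 2 * v → Y ∣ 2 * v' → K ∣ 6 → w ≠ 0 →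
      (X - Y) * (X + Y) = K * w ^ 2 → IsSquare ((X - Y : ℤ) : ZMod p) := by
    intro k v c k' v' c' X Y K w h h' hk hX hY hK hw hXY
    obtain ⟨d, hd, u, hu⟩ := exists_sqClass_sub X Y K w hK hw hXY (by
      intro q hq hqX hqY
      by_contra! hcon
      have hqI := Nat.prime_iff_prime_int.1 hq
      have hq2 : ¬(q : ℤ) ∣ 2 := fun h =>
        hcon.1 ((Nat.prime_dvd_prime_iff_eq hq Nat.prime_two).1 (by exact_mod_cast h))
      have h1 := hdvd h ((hqI.dvd_mul.1 (hqX.trans hX)).resolve_left hq2)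
      have h2 := hdvd h' ((hqI.dvd_mul.1 (hqY.trans hY)).resolve_left hq2)
      have h3 : (q : ℤ) ∣ (k - k') * t := by have := dvd_sub h2 h1; ring_nf at this ⊢; exact this
      have h4 : (q : ℤ) ∣ 2 * 6 :=
        ((hqI.dvd_mul.1 h3).resolve_right (hcop q hq k h1)).trans (by simpa using hk)
      rcases prime_dvd_six hq ((hqI.dvd_mul.1 h4).resolve_left hq2) with h | h
      · exact hcon.1 h
      · exact hcon.2 h)
    rw [hu]
    push_cast
    exact (ZMod.intCast_isSquare_of_mem hp48 hd).mul (IsSquare.sq _)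
  have hsq : ∀ d ∈ sixUnits, IsSquare (d : ZMod p) :=
    fun d hd => ZMod.intCast_isSquare_of_mem hp48 hd
  have hn0 : ∀ n : ℕ, 0 < n → n < 97 → (n : ZMod p) ≠ 0 := by
    intro n hn hn' h
    have h1 := Nat.le_of_dvd hn ((ZMod.natCast_eq_zero_iff n p).1 h)
    have : p ≠ 1 := hp.one_lt.ne'
    have : p ≠ 49 := by rintro rfl; norm_num at hp
    omega
  have h20 : (2 : ZMod p) ≠ 0 := by exact_mod_cast hn0 2 (by norm_num) (by norm_num)
  have h30 : (3 : ZMod p) ≠ 0 := by exact_mod_cast hn0 3 (by norm_num) (by norm_num)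
  have hκ : ∀ (c : ℤ) (κ m : ZMod p), c ∈ sixUnits → (c : ZMod p) ≠ 0 → c * κ = m ^ 2 →
      IsSquare κ := by
    intro c κ m hc hc0 h
    have : κ = m ^ 2 / c := by field_simp; linear_combination h
    rw [this]
    exact (IsSquare.sq _).div (hsq c hc)
  have n₁ := hne e₁
  have n₂ := hne e₂
  have n₃ := hne e₃
  have m₁ := congrArg (Int.cast : ℤ → ZMod p) e₁
  have m₂ := congrArg (Int.cast : ℤ → ZMod p) e₂
  have m₃ := congrArg (Int.cast : ℤ → ZMod p) e₃
  push_cast at m₁ m₂ m₃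
  rw [ht0, mul_zero, sub_zero] at m₁ m₂ m₃
  simp only [List.mem_cons, List.cons.injEq, List.not_mem_nil, or_false, and_true] at hd
  rcases hd with ⟨-, rfl, rfl, rfl⟩ | ⟨-, rfl, rfl, rfl⟩ | ⟨-, rfl, rfl, rfl⟩ | ⟨-, rfl, rfl, rfl⟩ |
    ⟨-, rfl, rfl, rfl⟩ | ⟨-, rfl, rfl, rfl⟩ <;> push_cast at m₁ m₂ m₃
  · have hr : ((u₁ : ZMod p) / u₃) ^ 2 = -3 := by field_simp; linear_combination m₃ - m₁
    refine two_eq_fourth_power hp48 u₃ u₂ (1 - u₁ / u₃) _ n₂ ?_ (hden 1 u₁ hu₂ e₂ (by norm_num)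
      ⟨6 * u₂, by linear_combination e₁ - e₂⟩) (hκ (-2) _ (1 + u₁ / u₃) (by decide) (by simpa) ?_)
      (hfac u₃ u₁ 2 (2 * u₂) e₃ e₁ (by norm_num) (by simp) (by simp) (by norm_num)
        (by simpa) (by linarith)) ?_ (Or.inl (mul_left_cancel₀ h30 ?_))
    · intro h
      rw [← sub_eq_zero.1 h] at hr
      exact mul_ne_zero h20 h20 (by linear_combination hr)
    · push_cast; linear_combination -hr
    · push_cast; field_simp
    · linear_combination m₃ - m₂
  · have hr : ((u₁ : ZMod p) / u₂) ^ 2 = 3 := by field_simp; linear_combination m₂ - m₁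
    refine two_eq_fourth_power hp48 u₂ u₃ (2 - u₁ / u₂) _ n₃ ?_ (hden 2 u₁ hu₃ e₃ (by norm_num)
      ⟨-6 * u₃, by linear_combination e₁ - e₃⟩) (hκ (2) _ (1 - u₁ / u₂) (by decide) (by simpa) ?_)
      (hfac (2 * u₂) u₁ 2 u₃ e₂ e₁ (by norm_num) (by simp) (by simp) (by norm_num)
        (by simpa) (by linarith)) ?_ (Or.inl (mul_left_cancel₀ h30 ?_))
    · intro h
      rw [← sub_eq_zero.1 h] at hr
      exact one_ne_zero (by linear_combination hr)
    · push_cast; linear_combination -hr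
    · push_cast; field_simp
    · linear_combination m₃ - m₂
  · have hfac' := hfac u₃ (2 * u₂) 6 u₁ e₃ e₂ (by norm_num) (by simp) (by simp) (by norm_num) hu₁
      (by linarith)
    have hden' := hden 1 u₂ hu₁ e₁ (by norm_num) ⟨2 * u₁, by linear_combination e₁ - e₂⟩
    rcases sq_eq_sq_iff_eq_or_eq_neg.1
      (show (u₃ : ZMod p) ^ 2 = (u₂ : ZMod p) ^ 2 by linear_combination m₃ - m₂) with h | h
    · refine two_eq_fourth_power hp48 u₂ u₁ ((-1 : ℤ) : ZMod p) _ n₁ (by simp) hden'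
        (hsq _ (by decide)) hfac' ?_ (Or.inr (by linear_combination m₂ - m₁))
      push_cast; rw [h]; ring
    · refine two_eq_fourth_power hp48 u₂ u₁ ((-3 : ℤ) : ZMod p) _ n₁ (by simpa) hden'
        (hsq _ (by decide)) hfac' ?_ (Or.inr (by linear_combination m₂ - m₁))
      push_cast; rw [h]; ring
  · have hfac' := hfac (2 * u₂) u₃ 6 u₁ e₂ e₃ (by norm_num) (by simp) (by simp) (by norm_num) hu₁
      (by linarith)
    have hden' := hden 1 u₂ hu₁ e₁ (by norm_num) ⟨-2 * u₁, by linear_combination e₁ - e₂⟩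
    rcases sq_eq_sq_iff_eq_or_eq_neg.1
      (show (u₃ : ZMod p) ^ 2 = (u₂ : ZMod p) ^ 2 by linear_combination m₃ - m₂) with h | h
    · refine two_eq_fourth_power hp48 u₂ u₁ ((1 : ℤ) : ZMod p) _ n₁ (by simp) hden'
        (hsq _ (by decide)) hfac' ?_ (Or.inl (by linear_combination m₂ - m₁))
      push_cast; rw [h]; ring
    · refine two_eq_fourth_power hp48 u₂ u₁ ((3 : ℤ) : ZMod p) _ n₁ (by simpa) hden'
        (hsq _ (by decide)) hfac' ?_ (Or.inl (by linear_combination m₂ - m₁))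
      push_cast; rw [h]; ring
  · have hr : ((u₁ : ZMod p) / u₂) ^ 2 = 3 := by field_simp; linear_combination m₂ - m₁
    refine two_eq_fourth_power hp48 u₂ u₃ (u₁ / u₂ - 2) _ n₃ ?_ (hden 2 u₁ hu₃ e₃ (by norm_num)
      ⟨6 * u₃, by linear_combination e₁ - e₃⟩) (hκ (-2) _ (1 - u₁ / u₂) (by decide) (by simpa) ?_)
      (hfac u₁ (2 * u₂) 2 u₃ e₁ e₂ (by norm_num) (by simp) (by simp) (by norm_num)
        (by simpa) (by linarith)) ?_ (Or.inr (mul_left_cancel₀ h30 ?_))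
    · intro h
      rw [sub_eq_zero.1 h] at hr
      exact one_ne_zero (by linear_combination hr)
    · push_cast; linear_combination -hr
    · push_cast; field_simp
    · linear_combination m₃ - m₂
  · have hr : ((u₁ : ZMod p) / u₃) ^ 2 = -3 := by field_simp; linear_combination m₃ - m₁
    refine two_eq_fourth_power hp48 u₃ u₂ (u₁ / u₃ - 1) _ n₂ ?_ (hden 1 u₁ hu₂ e₂ (by norm_num)
      ⟨-6 * u₂, by linear_combination e₁ - e₂⟩) (hκ (2) _ (1 + u₁ / u₃) (by decide) (by simpa) ?_)
      (hfac u₁ u₃ 2 (2 * u₂) e₁ e₃ (by norm_num) (by simp) (by simp) (by norm_num)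
        (by simpa) (by linarith)) ?_ (Or.inr (mul_left_cancel₀ h30 ?_))
    · intro h
      rw [sub_eq_zero.1 h] at hr
      exact mul_ne_zero h20 h20 (by linear_combination hr)
    · push_cast; linear_combination -hr
    · push_cast; field_simp
    · linear_combination m₃ - m₂

theorem dvd_den_of_mul_eq {p : ℕ} (hp : p.Prime) (x : ℚ) (α β : ℤ) (h : x * β = α)
    (hβ : (p : ℤ) ∣ β) (hα : ¬(p : ℤ) ∣ α) : (p : ℤ) ∣ x.den := by
  have h1 : x.num * β = x.den * α := by
    have : (x.num * β : ℚ) = x.den * α := by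
      rw [← h, ← Rat.mul_den_eq_num x]; ring
    exact_mod_cast this
  exact ((Nat.prime_iff_prime_int.1 hp).dvd_mul.1 (by rw [← h1]; exact hβ.mul_left _)).resolve_right
    hα

theorem exists_translate_dvd_den {p : ℕ} (hp : p.Prime) (hp6 : p ≠ 2 ∧ p ≠ 3) (D : ℤ) (x : ℚ)
    (hx : x * (x - (1 : ℤ)) * (x - (4 : ℤ)) ≠ 0)
    (hsq : IsSquare (D * (x * (x - (1 : ℤ)) * (x - (4 : ℤ))))) (i : Fin 4)
    (hi : (p : ℤ) ∣ linForm (quadForms 1 4 i) (x.num, (x.den : ℤ))) :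
    ∃ x' : ℚ, x' * (x' - (1 : ℤ)) * (x' - (4 : ℤ)) ≠ 0 ∧
      IsSquare (D * (x' * (x' - (1 : ℤ)) * (x' - (4 : ℤ)))) ∧ ratHeight x' ≤ 8 * ratHeight x ∧
      (p : ℤ) ∣ x'.den := by
  have hpI := Nat.prime_iff_prime_int.1 hp
  have hcop : IsCoprime x.num x.den := by rw [Int.isCoprime_iff_gcd_eq_one]; exact x.reduced
  have hn : (x.num : ℚ) = x * x.den := (Rat.mul_den_eq_num x).symm
  have hd : (x.den : ℚ) ≠ 0 := by exact_mod_cast x.den_nz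
  have hne : ∀ j, j ≠ i → ¬(p : ℤ) ∣ linForm (quadForms 1 4 j) (x.num, (x.den : ℤ)) := by
    intro j hj h
    have := prime_dvd_of_linForm (by decide) hcop hp hj h hi
    omega
  have hp4 : ∀ n : ℤ, ¬(p : ℤ) ∣ n → ¬(p : ℤ) ∣ 4 * n := by
    intro n hn h
    rcases hpI.dvd_mul.1 h with h | h
    · rcases hpI.dvd_mul.1 (show (p : ℤ) ∣ 2 * 2 by simpa using h) with h | h <;>
      exact hp6.1 ((Nat.prime_dvd_prime_iff_eq hp Nat.prime_two).1 (by exact_mod_cast h))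
    · exact hn h
  have hx0 : x ≠ 0 := fun h => hx (by rw [h]; ring)
  have hx1 : x - 1 ≠ 0 := fun h => hx (by push_cast; rw [h]; ring)
  have hx4 : x - 4 ≠ 0 := fun h => hx (by push_cast; rw [h]; ring)
  obtain ⟨y, hy⟩ := hsq
  push_cast at hy
  fin_cases i
  · exact ⟨x, hx, ⟨y, by push_cast; exact hy⟩, by omega, by simpa [quadForms, linForm] using hi⟩
  · refine ⟨4 / x, ?_, ⟨4 * y / x ^ 2, ?_⟩, ?_, dvd_den_of_mul_eq hp _ (4 * x.den) x.num ?_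
      (by simpa [quadForms, linForm] using hi)
      (hp4 _ (by simpa [quadForms, linForm] using hne 0 (by decide)))⟩
    · have : 4 / x * (4 / x - 1) * (4 / x - 4) = 16 * (x - 4) * (x - 1) / x ^ 3 := by
        field_simp; ring
      push_cast; rw [this]; positivity
    · push_cast; field_simp; linear_combination hy
    · have := ratHeight_moebius_le x 0 4 1 0 8 (by decide) (by decide) (by simpa using hx0)
      simpa using this
    · push_cast; rw [hn]; field_simp
  · refine ⟨(x - 4) / (x - 1), ?_, ⟨3 * y / (x - 1) ^ 2, ?_⟩, ?_,
      dvd_den_of_mul_eq hp _ (x.num - 4 * x.den) (x.num - x.den) ?_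
      (by simpa [quadForms, linForm, sub_eq_add_neg] using hi)
      (by simpa [quadForms, linForm, sub_eq_add_neg] using hne 3 (by decide))⟩
    · have : (x - 4) / (x - 1) * ((x - 4) / (x - 1) - 1) * ((x - 4) / (x - 1) - 4)
          = 9 * (x - 4) * x / (x - 1) ^ 3 := by
        field_simp; ring
      push_cast; rw [this]; positivity
    · push_cast; field_simp; linear_combination 9 * hy
    · have := ratHeight_moebius_le x 1 (-4) 1 (-1) 8 (by decide) (by decide)
        (by simpa [sub_eq_add_neg] using hx1)
      simpa [sub_eq_add_neg] using this
    · push_cast; rw [hn]; field_simp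
  · refine ⟨4 * (x - 1) / (x - 4), ?_, ⟨12 * y / (x - 4) ^ 2, ?_⟩, ?_,
      dvd_den_of_mul_eq hp _ (4 * (x.num - x.den)) (x.num - 4 * x.den) ?_
      (by simpa [quadForms, linForm, sub_eq_add_neg] using hi)
      (hp4 _ (by simpa [quadForms, linForm, sub_eq_add_neg] using hne 2 (by decide)))⟩
    · have : 4 * (x - 1) / (x - 4) * (4 * (x - 1) / (x - 4) - 1) * (4 * (x - 1) / (x - 4) - 4)
          = 144 * (x - 1) * x / (x - 4) ^ 3 := by
        field_simp; ring
      push_cast; rw [this]; positivity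
    · push_cast; field_simp; linear_combination 144 * hy
    · have := ratHeight_moebius_le x 4 (-4) 1 (-4) 8 (by decide) (by decide)
        (by simpa [sub_eq_add_neg] using hx4)
      convert this using 2
      push_cast; ring
    · push_cast; rw [hn]; field_simp

theorem no_point_twist {p : ℕ} (hp : p.Prime) (hp48 : p % 48 = 1)
    (h2 : ¬∃ z : ZMod p, z ^ 4 = 2) (D : ℤ) (hD : D ∣ 6) (good : Fin 4 → ℤ)
    (hgood : ∀ j, j ≠ 0 → IsSquare (D * good j * good 0))
    (goods : List (List ℤ))
    (hcheck : selmerCheck (List.ofFn (quadForms 1 4)) D (List.ofFn good :: goods) = true)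
    (hgoods : ∀ l ∈ goods, l ∈ [[1, 1, -6, -3], [1, 1, 3, 6], [1, 2, -1, -1],
      [1, -2, -1, -1], [1, 1, 3, -6], [1, 1, 6, -3]])
    (hsmall₁ : noSmallPoint 1 4 (D * 97) 46 = true)
    (hsmall₂ : noSmallPoint 1 4 (D * 193) 46 = true) (x : ℚ)
    (hx : IsSquare (((D * p : ℤ) : ℚ) * (x * (x - (1 : ℤ)) * (x - (4 : ℤ))))) :
    x * (x - (1 : ℤ)) * (x - (4 : ℤ)) = 0 := by
  have hp6 : p ≠ 2 ∧ p ≠ 3 := by omega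
  have hpI := Nat.prime_iff_prime_int.1 hp
  have hD0 : D * p ≠ 0 := mul_ne_zero (by rintro rfl; simp at hD) hpI.ne_zero
  have hsel : ∀ x : ℚ, x * (x - (1 : ℤ)) * (x - (4 : ℤ)) ≠ 0 →
      IsSquare (((D * p : ℤ) : ℚ) * (x * (x - (1 : ℤ)) * (x - (4 : ℤ)))) →
      ∃ (d u : Fin 4 → ℤ) (i₀ : Fin 4), List.ofFn d ∈ List.ofFn good :: goods ∧ (∀ i, u i ≠ 0) ∧
      ∀ i, linForm (quadForms 1 4 i) (x.num, (x.den : ℤ))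
        = d i * (if i = i₀ then (p : ℤ) else 1) * u i ^ 2 := by
    intro x hx0 hx
    obtain ⟨w, hw, hprod⟩ := exists_num_den_eq_sq 1 4 (D * p) x hx0 hD0 hx
    exact selmer_class (quadForms 1 4) p (Or.inr hp) hp48 (by decide) D hD _
      hcheck x.num x.den w (by rw [Int.isCoprime_iff_gcd_eq_one]; exact x.reduced)
      (by exact_mod_cast x.pos) hw hprod
  refine no_point_of_descent 1 4 (D * p) hD0 (by norm_num) (by norm_num) (by norm_num) 12480 8
    ratHeight_half_one_four_le ?_ ?_ x hx
  · intro x hx0 hx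
    obtain ⟨d, u, i₀, -, -, hL⟩ := hsel x hx0 hx
    obtain ⟨x', hx0', hx', hh, hpd⟩ := exists_translate_dvd_den hp hp6 (D * p) x hx0 hx i₀
      (by rw [hL, if_pos rfl]; exact (dvd_mul_left _ _).mul_right _)
    obtain ⟨d, u, i₀, hd, hu, hL⟩ := hsel x' hx0' hx'
    have hcop : IsCoprime x'.num x'.den := by
      rw [Int.isCoprime_iff_gcd_eq_one]; exact x'.reduced
    obtain rfl : i₀ = 0 := by
      by_contra hi
      have := prime_dvd_of_linForm (c := quadForms 1 4) (by decide) hcop hp hi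
        (by rw [hL, if_pos rfl]; exact (dvd_mul_left _ _).mul_right _)
        (by simpa [quadForms, linForm] using hpd)
      omega
    have e₀ : (x'.den : ℤ) = d 0 * p * u 0 ^ 2 := by simpa [quadForms, linForm] using hL 0
    have e₁ : x'.num = d 1 * u 1 ^ 2 := by simpa [quadForms, linForm] using hL 1
    have e₂ : x'.num - x'.den = d 2 * u 2 ^ 2 := by
      simpa [quadForms, linForm, sub_eq_add_neg] using hL 2
    have e₃ : x'.num - 4 * x'.den = d 3 * u 3 ^ 2 := by
      simpa [quadForms, linForm, sub_eq_add_neg] using hL 3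
    rcases List.mem_cons.1 hd with h | h
    · obtain rfl := List.ofFn_injective h
      have hx0 : (x'.den : ℚ) ≠ 0 := by exact_mod_cast x'.den_nz
      have hd0 : p * d 0 ≠ 0 := by
        intro h; apply x'.den_nz; rw [mul_comm] at h; rw [h] at e₀; simp at e₀
      have hn : (x'.num : ℚ) = x' * x'.den := (Rat.mul_den_eq_num x').symm
      have key : ∀ j : Fin 4, j ≠ 0 → IsSquare (D * p * 1 * d j * (p * d 0)) := by
        intro j hj
        have h : D * p * 1 * d j * (p * d 0) = D * d j * d 0 * (p : ℤ) ^ 2 := by ring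
        rw [h]
        exact (hgood j hj).mul (IsSquare.sq (p : ℤ))
      have e₀' : ((p * d 0 * u 0 ^ 2 : ℤ) : ℚ) = x'.den := by
        rw [mul_comm (p : ℤ), ← e₀]; simp
      refine ⟨x', ?_, ?_, ?_, hh⟩
      · convert isSquare_ratio (D * p) 1 (d 1) (p * d 0) (u 1) (u 0) hd0 (hu 0) (key 1 (by decide)) using 2
        rw [e₀', ← e₁, hn]; push_cast; field_simp
      · convert isSquare_ratio (D * p) 1 (d 2) (p * d 0) (u 2) (u 0) hd0 (hu 0) (key 2 (by decide)) using 2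
        rw [e₀', ← e₂]; push_cast; rw [hn]; field_simp
      · convert isSquare_ratio (D * p) 1 (d 3) (p * d 0) (u 3) (u 0) hd0 (hu 0) (key 3 (by decide)) using 2
        rw [e₀', ← e₃]; push_cast; rw [hn]; field_simp
    · refine (twist_class_infinity hp hp48 h2 x'.num x'.den (u 0) (u 1) (u 2) (u 3) (d 0) (d 1)
        (d 2) (d 3) hcop (hu 1) (hu 2) (hu 3) (by simpa using hgoods _ h) e₀ ?_ ?_ e₃).elim
      · rw [zero_mul, sub_zero]; exact e₁
      · rw [one_mul]; exact e₂
  · intro z hz hsq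
    have hlt : 46 < ratHeight z := by
      by_contra! hle
      obtain ⟨d, u, i, -, -, hL⟩ := hsel z hz hsq
      obtain ⟨w, hw, hprod⟩ := exists_num_den_eq_sq 1 4 (D * p) z hz hD0 hsq
      have hne : linForm (quadForms 1 4 i) (z.num, (z.den : ℤ)) ≠ 0 := by
        intro h
        rw [Finset.prod_eq_zero (Finset.mem_univ i) h, mul_zero] at hprod
        exact hw (pow_eq_zero_iff two_ne_zero |>.1 hprod.symm)
      have hdvd : (p : ℤ) ∣ linForm (quadForms 1 4 i) (z.num, (z.den : ℤ)) := by
        rw [hL, if_pos rfl]; exact (dvd_mul_left _ _).mul_right _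
      have hm := abs_num_le_ratHeight z
      have hn := den_le_ratHeight z
      have hle' : |linForm (quadForms 1 4 i) (z.num, (z.den : ℤ))| ≤ 230 := by
        have hm' := abs_le.1 hm
        rw [abs_le]
        fin_cases i <;> simp [quadForms, linForm] <;> omega
      have hp230 : (p : ℤ) ≤ 230 :=
        (Int.le_of_dvd (abs_pos.2 hne) ((dvd_abs _ _).2 hdvd)).trans hle'
      have hp' : p = 97 ∨ p = 193 := by
        have : p = 1 ∨ p = 49 ∨ p = 97 ∨ p = 145 ∨ p = 193 := by omega
        rcases this with rfl | rfl | rfl | rfl | rfl <;> revert hp <;> norm_num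
      rcases hp' with rfl | rfl
      · exact absurd (lt_ratHeight_of_noSmallPoint 1 4 _ hD0 46 hsmall₁ z hz hsq) (by omega)
      · exact absurd (lt_ratHeight_of_noSmallPoint 1 4 _ hD0 46 hsmall₂ z hz hsq) (by omega)
    exact lt_of_lt_of_le (by norm_num) (Nat.pow_le_pow_left (Nat.succ_le_of_lt hlt) 3)

theorem eq_zero_of_twist {p : ℕ} (hp : p.Prime) (hp48 : p % 48 = 1)
    (h2 : ¬∃ z : ZMod p, z ^ 4 = 2) {D : ℤ} (hD : D ∈ [2, -2]) {s t w : ℤ}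
    (h : D * p * (t * s * (s - t) * (s - 4 * t)) = w ^ 2) : w = 0 := by
  refine eq_zero_of_no_point 1 4 (D * p) ?_ s t w (by rw [one_mul]; exact h)
  simp only [List.mem_cons, List.not_mem_nil, or_false] at hD
  rcases hD with rfl | rfl
  · exact no_point_twist hp hp48 h2 2 (by decide) ![2, 1, 1, 1] (by decide +kernel)
      [[1, 1, -6, -3], [1, 1, 3, 6], [1, 2, -1, -1]]
      (by decide +kernel) (by decide) (by decide +kernel) (by decide +kernel)
  · exact no_point_twist hp hp48 h2 (-2) (by decide) ![2, -1, -1, -1] (by decide +kernel)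
      [[1, -2, -1, -1], [1, 1, 3, -6], [1, 1, 6, -3]]
      (by decide +kernel) (by decide) (by decide +kernel) (by decide +kernel)

/-- The linear forms `b`, `a`, `a - b`, `a + b`, `a - 2 b`, `a + 2 b`. -/
def sextForms : Fin 6 → ℤ × ℤ := ![(0, 1), (1, 0), (1, -1), (1, 1), (1, -2), (1, 2)]

/-- The relations `α l_i - β l_j = γ l_k` and `α l_i - B β l_j = δ l_m` map the points of the
genus `2` curve whose square classes are `d`, with the prime `p` at position `i₀`, to one of the
curves `D y² = x (x - 1) (x - B)` or `D p y² = x (x - 1) (x - B)` having only trivial points. -/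
def IsExcluding (d : Fin 6 → ℤ) (i₀ : Fin 6) (D B : ℤ) (i j k m : Fin 6) (α β γ δ : ℤ) : Prop :=
  (α * (sextForms i).1 - β * (sextForms j).1 = γ * (sextForms k).1 ∧
    α * (sextForms i).2 - β * (sextForms j).2 = γ * (sextForms k).2) ∧
  (α * (sextForms i).1 - B * β * (sextForms j).1 = δ * (sextForms m).1 ∧
    α * (sextForms i).2 - B * β * (sextForms j).2 = δ * (sextForms m).2) ∧
  D * (α * d i * (β * d j) * (γ * d k) * (δ * d m)) ≠ 0 ∧
  IsSquare (D * (α * d i * (β * d j) * (γ * d k) * (δ * d m))) ∧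
  (B = 4 ∧ D ∈ [1, 2, -2] ∧ i₀ ∉ [i, j, k, m] ∨ B = -1 ∧ D ∈ [1, 2] ∧ i₀ ∉ [i, j, k, m] ∨
    B = 4 ∧ D ∈ [2, -2] ∧ [i, j, k, m].Nodup ∧ i₀ ∈ [i, j, k, m])

instance (d : Fin 6 → ℤ) (i₀ : Fin 6) (D B : ℤ) (i j k m : Fin 6) (α β γ δ : ℤ) :
    Decidable (IsExcluding d i₀ D B i j k m α β γ δ) := by
  unfold IsExcluding; infer_instance

theorem false_of_isExcluding {p : ℕ} (hp : p.Prime) (hp48 : p % 48 = 1)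
    (h2 : ¬∃ z : ZMod p, z ^ 4 = 2) {d u : Fin 6 → ℤ} {i₀ : Fin 6} {v : ℤ × ℤ}
    (hu : ∀ i, u i ≠ 0)
    (hL : ∀ i, linForm (sextForms i) v = d i * (if i = i₀ then (p : ℤ) else 1) * u i ^ 2)
    (D B : ℤ) (i j k m : Fin 6) (α β γ δ : ℤ) (h : IsExcluding d i₀ D B i j k m α β γ δ) :
    False := by
  obtain ⟨⟨hk, hk'⟩, ⟨hm, hm'⟩, hne, ⟨r, hr⟩, hcases⟩ := h
  have hp0 : (p : ℤ) ≠ 0 := by exact_mod_cast hp.ne_zero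
  have hr0 : r ≠ 0 := by rintro rfl; exact hne (by rw [hr, mul_zero])
  have hw : r * (u i * u j * u k * u m) ≠ 0 := by simp [hr0, hu]
  have ek : α * linForm (sextForms i) v - β * linForm (sextForms j) v
      = γ * linForm (sextForms k) v := by
    simp only [linForm]; linear_combination v.1 * hk + v.2 * hk'
  have em : α * linForm (sextForms i) v - B * (β * linForm (sextForms j) v)
      = δ * linForm (sextForms m) v := by
    simp only [linForm]; linear_combination v.1 * hm + v.2 * hm'
  have key : ∀ P Q : ℤ, P * ((if i = i₀ then (p : ℤ) else 1) * (if j = i₀ then (p : ℤ) else 1) *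
      (if k = i₀ then (p : ℤ) else 1) * (if m = i₀ then (p : ℤ) else 1)) = Q ^ 2 →
      D * P * (β * linForm (sextForms j) v * (α * linForm (sextForms i) v) *
      (α * linForm (sextForms i) v - β * linForm (sextForms j) v) *
      (α * linForm (sextForms i) v - B * (β * linForm (sextForms j) v)))
      = (Q * (r * (u i * u j * u k * u m))) ^ 2 := by
    intro P Q hPQ
    rw [ek, em, hL i, hL j, hL k, hL m, mul_pow, ← hPQ]
    linear_combination P * ((if i = i₀ then (p : ℤ) else 1) * (if j = i₀ then (p : ℤ) else 1) *
      (if k = i₀ then (p : ℤ) else 1) * (if m = i₀ then (p : ℤ) else 1)) *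
      (u i * u j * u k * u m) ^ 2 * hr
  have hw' := mul_ne_zero one_ne_zero hw
  rcases hcases with ⟨rfl, hD, hi⟩ | ⟨rfl, hD, hi⟩ | ⟨rfl, hD, hnd, hi⟩
  · simp only [List.mem_cons, List.not_mem_nil, or_false, not_or, eq_comm (a := i₀)] at hi
    have h1 := key 1 1 (by simp [hi])
    rw [mul_one] at h1
    exact hw' (eq_zero_of_one_four hD h1)
  · simp only [List.mem_cons, List.not_mem_nil, or_false, not_or, eq_comm (a := i₀)] at hi
    have h1 := key 1 1 (by simp [hi])
    rw [mul_one, neg_one_mul, sub_neg_eq_add] at h1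
    exact hw' (eq_zero_of_congruent hD h1)
  · have h1 := key p p (by
      simp only [List.nodup_cons, List.mem_cons, List.not_mem_nil, or_false, not_or] at hnd hi
      rcases hi with rfl | rfl | rfl | rfl <;> grind)
    exact mul_ne_zero hp0 hw (eq_zero_of_twist hp hp48 h2 hD h1)

/-- The classes surviving the local conditions on the genus `2` curve. -/
def sextClasses : List (List ℤ) :=
  [[1, -2, -3, -1, -1, 6], [1, -1, -2, -6, -3, 1], [1, 1, -6, 2, -1, 3], [1, 1, -1, 1, -2, 2],
    [1, 1, 1, 1, 1, 1], [1, 2, 1, 3, 6, 1]]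

theorem selmerCheck_sextForms : selmerCheck (List.ofFn sextForms) 1 sextClasses = true := by
  decide +kernel

theorem isExcluding_of_mem_sextClasses : ∀ l ∈ sextClasses, ∀ i₀,
    l = [1, 1, 1, 1, 1, 1] ∧ i₀ = 0 ∨
    IsExcluding (fun i => l.getD i 0) i₀ (-2) 4 4 0 2 5 1 (-1) 1 1 ∨
    IsExcluding (fun i => l.getD i 0) i₀ 2 4 5 0 3 4 1 1 1 1 ∨
    IsExcluding (fun i => l.getD i 0) i₀ (-2) 4 1 2 3 4 2 1 1 (-2) ∨
    IsExcluding (fun i => l.getD i 0) i₀ 1 (-1) 0 1 3 2 1 (-1) 1 (-1) ∨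
    IsExcluding (fun i => l.getD i 0) i₀ 2 (-1) 0 1 5 4 2 (-1) 1 (-1) ∨
    IsExcluding (fun i => l.getD i 0) i₀ 1 4 5 0 3 4 1 1 1 1 := by
  decide +kernel

theorem false_of_sextForms {p : ℕ} (hp : p.Prime) (hp48 : p % 48 = 1)
    (h2 : ¬∃ z : ZMod p, z ^ 4 = 2) (a b w : ℤ) (hab : IsCoprime a b) (hb : 0 < b) (hw : w ≠ 0)
    (h : p * ∏ i, linForm (sextForms i) (a, b) = w ^ 2) : False := by
  obtain ⟨d, u, i₀, hd, hu, hL⟩ := selmer_class sextForms p (Or.inr hp) hp48 (by decide +kernel) 1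
    (by decide) sextClasses selmerCheck_sextForms a b w hab hb hw (by simpa using h)
  have hex := isExcluding_of_mem_sextClasses _ hd i₀
  have hdd : (fun i : Fin 6 => (List.ofFn d).getD i 0) = d := by
    funext i; fin_cases i <;> simp
  rw [hdd] at hex
  have kill := false_of_isExcluding hp hp48 h2 hu hL
  rcases hex with ⟨h1, rfl⟩ | h | h | h | h | h | h
  · have hd1 : ∀ i, d i = 1 := by
      intro i
      rw [← congrFun hdd i, h1]
      fin_cases i <;> rfl
    have e := fun i => hL i
    simp only [hd1] at e
    have e1 : a = u 1 ^ 2 := by simpa [sextForms, linForm] using e 1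
    have e2 : a - b = u 2 ^ 2 := by simpa [sextForms, linForm, sub_eq_add_neg] using e 2
    have e3 : a + b = u 3 ^ 2 := by simpa [sextForms, linForm] using e 3
    have e4 : a - 2 * b = u 4 ^ 2 := by simpa [sextForms, linForm, sub_eq_add_neg] using e 4
    have e5 : a + 2 * b = u 5 ^ 2 := by simpa [sextForms, linForm] using e 5
    have h0 : u 1 ^ 2 * b * (u 2 * u 3 * u 4 * u 5) = 0 := by
      refine eq_zero_of_one_four (D := 1) (by decide) (s := a ^ 2) (t := b ^ 2) ?_
      simp only [mul_pow, ← e2, ← e3, ← e4, ← e5]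
      rw [← e1]; ring
    simp [hu, hb.ne'] at h0
  all_goals exact kill _ _ _ _ _ _ _ _ _ _ h

/-- For a prime `p ≡ 1 (mod 48)` such that `X⁴ − 2X² − 2` has a root mod `p` but `2` is
not a fourth power mod `p` (i.e. `p` splits completely in `ℚ(√(1+√3))` and not in
`ℚ(2^{1/4})`), every rational point on `C_p : y² = x(x² − p²)(x² − 4p²)` has `y = 0`. -/
theorem rational_points_Cp_of_one_mod_48_case_b (p : ℕ) (hp : Nat.Prime p) (hmod : p % 48 = 1)
    (h3 : ∃ w : ZMod p, w ^ 4 - 2 * w ^ 2 - 2 = 0)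
    (h2 : ¬∃ z : ZMod p, z ^ 4 = 2)
    (x y : ℚ) (h : y ^ 2 = x * (x ^ 2 - (p : ℚ) ^ 2) * (x ^ 2 - 4 * (p : ℚ) ^ 2)) :
    y = 0 ∧ (x = 0 ∨ x = p ∨ x = -p ∨ x = 2 * p ∨ x = -(2 * p)) := by
  have hp0 : (p : ℚ) ≠ 0 := by exact_mod_cast hp.ne_zero
  have hy : y = 0 := by
    by_contra hy
    set X := x / p with hX
    have hx : x = p * X := by rw [hX]; field_simp
    have hn : (X.num : ℚ) = X * X.den := (Rat.mul_den_eq_num X).symm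
    have hd : (X.den : ℚ) ≠ 0 := by exact_mod_cast X.den_nz
    have hprod : ((p * ∏ i, linForm (sextForms i) (X.num, (X.den : ℤ)) : ℤ) : ℚ)
        = (y * X.den ^ 3 / p ^ 2) ^ 2 := by
      simp [Fin.prod_univ_six, sextForms, linForm]
      rw [hn]
      field_simp
      rw [h, hx]
      ring
    obtain ⟨w, hw⟩ := Rat.isSquare_intCast_iff.1 ⟨_, hprod.trans (pow_two _)⟩
    refine false_of_sextForms hp hmod h2 X.num X.den w
      (by rw [Int.isCoprime_iff_gcd_eq_one]; exact X.reduced) (by exact_mod_cast X.pos) ?_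
      (by rw [hw, pow_two])
    rintro rfl
    rw [hw] at hprod
    have : y * X.den ^ 3 / p ^ 2 ≠ 0 := by positivity
    exact pow_ne_zero 2 this (by rw [← hprod]; simp)
  refine ⟨hy, ?_⟩
  rw [hy] at h
  have hf : x * ((x - p) * (x + p)) * ((x - 2 * p) * (x + 2 * p)) = 0 := by linear_combination -h
  simp only [mul_eq_zero, sub_eq_zero, add_eq_zero_iff_eq_neg] at hf
  tauto
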